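/- arXiv:1801.00654 — 2 statements merged into one kernel-verified Lean document; each statement's English description precedes it below -/
import Mathlib

section
/- For a simple 𝔤₀-supermodule V, there are isomorphisms of 𝔤-supermodules, up to parity change: Coind_{𝔤≥0}^𝔤(Λ^max(𝔤₋₁) ⊗ V) ≅ K(V) and Coind_{𝔤≥0}^𝔤(V) ≅ K(Λ^max(𝔤₋₁*) ⊗ V); similarly, Coind_{𝔤≤0}^𝔤(Λ^max(𝔤₁) ⊗ V) ≅ K'(V) and Coind_{𝔤≤0}^𝔤(V) ≅ K'(Λ^max(𝔤₁*) ⊗ V). -/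
noncomputable section

open Module Function

/-- A complex Lie superalgebra `𝔤 = 𝔤₀̄ ⊕ 𝔤₁̄` equipped with a compatible `ℤ`-grading
`𝔤 = 𝔤₋₁ ⊕ 𝔤₀ ⊕ 𝔤₁`, i.e. `𝔤₀ = 𝔤₀̄`, `𝔤₁̄ = 𝔤₁ ⊕ 𝔤₋₁`, the pieces `𝔤±₁` are
`𝔤₀̄`-submodules and `[𝔤₁,𝔤₁] = [𝔤₋₁,𝔤₋₁] = 0`.  The super skew-symmetry and the super
Jacobi identity are imposed on (parity-)homogeneous elements, as usual. -/
structure GLSA where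
  carrier : Type
  [isACG : AddCommGroup carrier]
  [isMod : Module ℂ carrier]
  bracket : carrier →ₗ[ℂ] carrier →ₗ[ℂ] carrier
  gneg : Submodule ℂ carrier
  g0 : Submodule ℂ carrier
  gpos : Submodule ℂ carrier
  oddCompl : IsCompl g0 (gneg ⊔ gpos)
  disjNP : Disjoint gneg gpos
  br_00 : ∀ x ∈ g0, ∀ y ∈ g0, bracket x y ∈ g0
  br_0p : ∀ x ∈ g0, ∀ y ∈ gpos, bracket x y ∈ gpos
  br_0n : ∀ x ∈ g0, ∀ y ∈ gneg, bracket x y ∈ gneg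
  br_pn : ∀ x ∈ gpos, ∀ y ∈ gneg, bracket x y ∈ g0
  br_pp : ∀ x ∈ gpos, ∀ y ∈ gpos, bracket x y = 0
  br_nn : ∀ x ∈ gneg, ∀ y ∈ gneg, bracket x y = 0
  skew_e : ∀ x ∈ g0, ∀ y, bracket x y = - bracket y x
  skew_oo : ∀ x ∈ gneg ⊔ gpos, ∀ y ∈ gneg ⊔ gpos, bracket x y = bracket y x
  jacobi_e : ∀ x y z : carrier, (x ∈ g0 ∨ y ∈ g0) →
    bracket x (bracket y z) = bracket (bracket x y) z + bracket y (bracket x z)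
  jacobi_oo : ∀ x ∈ gneg ⊔ gpos, ∀ y ∈ gneg ⊔ gpos, ∀ z,
    bracket x (bracket y z) = bracket (bracket x y) z - bracket y (bracket x z)

attribute [instance] GLSA.isACG GLSA.isMod

/-- The odd part `𝔤₁̄ = 𝔤₋₁ ⊕ 𝔤₁` of `L`. -/
def GLSA.odd (L : GLSA) : Submodule ℂ L.carrier := L.gneg ⊔ L.gpos

/-- A `𝔤`-supermodule: a `ℤ₂`-graded complex vector space with a compatible action of the
Lie superalgebra `L` (signs in the compatibility with the bracket are imposed on
homogeneous elements). -/
structure SMod (L : GLSA) where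
  carrier : Type
  [isACG : AddCommGroup carrier]
  [isMod : Module ℂ carrier]
  act : L.carrier →ₗ[ℂ] carrier →ₗ[ℂ] carrier
  ev : Submodule ℂ carrier
  od : Submodule ℂ carrier
  grading : IsCompl ev od
  act_e_ev : ∀ x ∈ L.g0, ∀ m ∈ ev, act x m ∈ ev
  act_e_od : ∀ x ∈ L.g0, ∀ m ∈ od, act x m ∈ od
  act_o_ev : ∀ x ∈ L.odd, ∀ m ∈ ev, act x m ∈ od
  act_o_od : ∀ x ∈ L.odd, ∀ m ∈ od, act x m ∈ ev
  act_br_e : ∀ x y : L.carrier, (x ∈ L.g0 ∨ y ∈ L.g0) → ∀ m,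
    act (L.bracket x y) m = act x (act y m) - act y (act x m)
  act_br_oo : ∀ x ∈ L.odd, ∀ y ∈ L.odd, ∀ m,
    act (L.bracket x y) m = act x (act y m) + act y (act x m)

attribute [instance] SMod.isACG SMod.isMod

/-- A `𝔤₀̄`-supermodule: a `ℤ₂`-graded complex vector space with an action of the (purely
even) Lie algebra `𝔤₀̄ = 𝔤₀` preserving the grading. -/
structure SMod0 (L : GLSA) where
  carrier : Type
  [isACG : AddCommGroup carrier]
  [isMod : Module ℂ carrier]
  act : ↥L.g0 →ₗ[ℂ] carrier →ₗ[ℂ] carrier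
  ev : Submodule ℂ carrier
  od : Submodule ℂ carrier
  grading : IsCompl ev od
  act_ev : ∀ (x : L.g0), ∀ m ∈ ev, act x m ∈ ev
  act_od : ∀ (x : L.g0), ∀ m ∈ od, act x m ∈ od
  act_br : ∀ (x y : L.g0) (m : carrier),
    act ⟨L.bracket ↑x ↑y, L.br_00 ↑x x.2 ↑y y.2⟩ m = act x (act y m) - act y (act x m)

attribute [instance] SMod0.isACG SMod0.isMod

/-- A homomorphism of `𝔤`-supermodules (homogeneous of degree zero). -/
structure SHom {L : GLSA} (M N : SMod L) where
  toLin : M.carrier →ₗ[ℂ] N.carrier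
  map_ev : ∀ m ∈ M.ev, toLin m ∈ N.ev
  map_od : ∀ m ∈ M.od, toLin m ∈ N.od
  equivar : ∀ (x : L.carrier) (m : M.carrier), toLin (M.act x m) = N.act x (toLin m)

/-- Isomorphism of `𝔤`-supermodules. -/
def SIso {L : GLSA} (M N : SMod L) : Prop := ∃ f : SHom M N, Bijective f.toLin

/-- Isomorphism of `𝔤₀̄`-supermodules. -/
def SIso0 {L : GLSA} (V W : SMod0 L) : Prop :=
  ∃ e : V.carrier ≃ₗ[ℂ] W.carrier,
    (∀ v ∈ V.ev, e v ∈ W.ev) ∧ (∀ v ∈ V.od, e v ∈ W.od) ∧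
    (∀ (x : L.g0) (v : V.carrier), e (V.act x v) = W.act x (e v))

/-- Isomorphism of `𝔤`-supermodules up to parity change. -/
def SIsoUpToParity {L : GLSA} (M N : SMod L) : Prop :=
  ∃ e : M.carrier ≃ₗ[ℂ] N.carrier,
    (∀ (x : L.carrier) (m : M.carrier), e (M.act x m) = N.act x (e m)) ∧
    (((∀ m ∈ M.ev, e m ∈ N.ev) ∧ (∀ m ∈ M.od, e m ∈ N.od)) ∨
     ((∀ m ∈ M.ev, e m ∈ N.od) ∧ (∀ m ∈ M.od, e m ∈ N.ev)))

namespace SMod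

variable {L : GLSA}

/-- A (graded) sub-supermodule of a `𝔤`-supermodule. -/
def IsSubmod (M : SMod L) (N : Submodule ℂ M.carrier) : Prop :=
  (∀ (x : L.carrier), ∀ m ∈ N, M.act x m ∈ N) ∧ N ≤ (N ⊓ M.ev) ⊔ (N ⊓ M.od)

/-- A simple sub-supermodule. -/
def IsSimpleSub (M : SMod L) (N : Submodule ℂ M.carrier) : Prop :=
  M.IsSubmod N ∧ N ≠ ⊥ ∧ ∀ N', M.IsSubmod N' → N' ≤ N → N' = ⊥ ∨ N' = N

/-- The socle: the sum of all simple sub-supermodules. -/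
def socle (M : SMod L) : Submodule ℂ M.carrier := sSup {N | M.IsSimpleSub N}

/-- The sub-supermodule generated by a subspace, i.e. `U(𝔤)·S`. -/
def gen (M : SMod L) (S : Submodule ℂ M.carrier) : Submodule ℂ M.carrier :=
  sInf {N | M.IsSubmod N ∧ S ≤ N}

/-- Simplicity of a `𝔤`-supermodule. -/
def IsSimple (M : SMod L) : Prop :=
  (⊤ : Submodule ℂ M.carrier) ≠ ⊥ ∧ ∀ N, M.IsSubmod N → N = ⊥ ∨ N = ⊤

/-- Indecomposability of a `𝔤`-supermodule. -/
def Indecomposable (M : SMod L) : Prop :=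
  (⊤ : Submodule ℂ M.carrier) ≠ ⊥ ∧
  ∀ N₁ N₂, M.IsSubmod N₁ → M.IsSubmod N₂ → N₁ ⊓ N₂ = ⊥ → N₁ ⊔ N₂ = ⊤ →
    N₁ = ⊥ ∨ N₂ = ⊥

/-- The parity change functor `Π`. -/
def pshift (M : SMod L) : SMod L where
  carrier := M.carrier
  act := M.act
  ev := M.od
  od := M.ev
  grading := M.grading.symm
  act_e_ev := M.act_e_od
  act_e_od := M.act_e_ev
  act_o_ev := M.act_o_od
  act_o_od := M.act_o_ev
  act_br_e := M.act_br_e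
  act_br_oo := M.act_br_oo

/-- The space `M^{𝔤₁}` of `𝔤₁`-invariants. -/
def invPos (M : SMod L) : Submodule ℂ M.carrier where
  carrier := {m | ∀ x ∈ L.gpos, M.act x m = 0}
  add_mem' := by
    intro a b ha hb x hx
    rw [map_add, ha x hx, hb x hx, add_zero]
  zero_mem' := by intro x hx; simp
  smul_mem' := by
    intro c a ha x hx
    rw [map_smul, ha x hx, smul_zero]

/-- The space `M^{𝔤₋₁}` of `𝔤₋₁`-invariants. -/
def invNeg (M : SMod L) : Submodule ℂ M.carrier where
  carrier := {m | ∀ x ∈ L.gneg, M.act x m = 0}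
  add_mem' := by
    intro a b ha hb x hx
    rw [map_add, ha x hx, hb x hx, add_zero]
  zero_mem' := by intro x hx; simp
  smul_mem' := by
    intro c a ha x hx
    rw [map_smul, ha x hx, smul_zero]

/-- Iterated action of a list of elements of `𝔤`. -/
def actList (M : SMod L) : List L.carrier → M.carrier → M.carrier
  | [], m => m
  | x :: xs, m => M.act x (M.actList xs m)

end SMod

namespace SMod0

variable {L : GLSA}

/-- A (graded) sub-supermodule of a `𝔤₀̄`-supermodule. -/
def IsSubmod (V : SMod0 L) (N : Submodule ℂ V.carrier) : Prop :=
  (∀ (x : L.g0), ∀ v ∈ N, V.act x v ∈ N) ∧ N ≤ (N ⊓ V.ev) ⊔ (N ⊓ V.od)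

/-- Simplicity of a `𝔤₀̄`-supermodule. -/
def IsSimple (V : SMod0 L) : Prop :=
  (⊤ : Submodule ℂ V.carrier) ≠ ⊥ ∧ ∀ N, V.IsSubmod N → N = ⊥ ∨ N = ⊤

end SMod0

/-- `IsKac V K η` expresses that `K`, together with the (even, `𝔤₀̄`-equivariant) unit map
`η : V → K` whose image is annihilated by `𝔤₁`, is *the* Kac module
`K(V) = Ind_{𝔤≥0}^{𝔤} V` of the `𝔤₀̄`-supermodule `V` (on which `𝔤₁` acts by zero), i.e.
satisfies the universal property `Hom_𝔤(K(V), M) = Hom_{𝔤₀̄}(V, M^{𝔤₁})`. -/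
structure IsKac {L : GLSA} (V : SMod0 L) (K : SMod L) (η : V.carrier →ₗ[ℂ] K.carrier) : Prop where
  map_ev : ∀ v ∈ V.ev, η v ∈ K.ev
  map_od : ∀ v ∈ V.od, η v ∈ K.od
  equivar : ∀ (x : L.g0) (v : V.carrier), η (V.act x v) = K.act ↑x (η v)
  pos_zero : ∀ x ∈ L.gpos, ∀ v : V.carrier, K.act x (η v) = 0
  injective : Injective η
  generates : K.gen (LinearMap.range η) = ⊤
  universal : ∀ (M : SMod L) (φ : V.carrier →ₗ[ℂ] M.carrier),
    (∀ v ∈ V.ev, φ v ∈ M.ev) → (∀ v ∈ V.od, φ v ∈ M.od) →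
    (∀ (x : L.g0) (v : V.carrier), φ (V.act x v) = M.act ↑x (φ v)) →
    (∀ x ∈ L.gpos, ∀ v : V.carrier, M.act x (φ v) = 0) →
    ∃! Φ : SHom K M, ∀ v, Φ.toLin (η v) = φ v

/-- The opposite Kac module `K'(V) = Ind_{𝔤≤0}^{𝔤} V` (with `𝔤₋₁` acting by zero on `V`),
described by its universal property. -/
structure IsKac' {L : GLSA} (V : SMod0 L) (K : SMod L) (η : V.carrier →ₗ[ℂ] K.carrier) : Prop where
  map_ev : ∀ v ∈ V.ev, η v ∈ K.ev
  map_od : ∀ v ∈ V.od, η v ∈ K.od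
  equivar : ∀ (x : L.g0) (v : V.carrier), η (V.act x v) = K.act ↑x (η v)
  neg_zero : ∀ x ∈ L.gneg, ∀ v : V.carrier, K.act x (η v) = 0
  injective : Injective η
  generates : K.gen (LinearMap.range η) = ⊤
  universal : ∀ (M : SMod L) (φ : V.carrier →ₗ[ℂ] M.carrier),
    (∀ v ∈ V.ev, φ v ∈ M.ev) → (∀ v ∈ V.od, φ v ∈ M.od) →
    (∀ (x : L.g0) (v : V.carrier), φ (V.act x v) = M.act ↑x (φ v)) →
    (∀ x ∈ L.gneg, ∀ v : V.carrier, M.act x (φ v) = 0) →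
    ∃! Φ : SHom K M, ∀ v, Φ.toLin (η v) = φ v

/-- `IsCoindPos W C ε` expresses that `C`, together with the (even, `𝔤₀̄`-equivariant)
counit `ε : C → W` killing `𝔤₁·C`, is the coinduced module `Coind_{𝔤≥0}^{𝔤}(W)` of the
`𝔤₀̄`-supermodule `W` (with `𝔤₁` acting by zero), i.e. satisfies the universal property
`Hom_𝔤(M, Coind(W)) = Hom_{𝔤≥0}(Res M, W)`. -/
structure IsCoindPos {L : GLSA} (W : SMod0 L) (C : SMod L) (ε : C.carrier →ₗ[ℂ] W.carrier) : Prop where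
  map_ev : ∀ c ∈ C.ev, ε c ∈ W.ev
  map_od : ∀ c ∈ C.od, ε c ∈ W.od
  equivar : ∀ (x : L.g0) (c : C.carrier), ε (C.act ↑x c) = W.act x (ε c)
  pos_zero : ∀ x ∈ L.gpos, ∀ c : C.carrier, ε (C.act x c) = 0
  universal : ∀ (M : SMod L) (ψ : M.carrier →ₗ[ℂ] W.carrier),
    (∀ m ∈ M.ev, ψ m ∈ W.ev) → (∀ m ∈ M.od, ψ m ∈ W.od) →
    (∀ (x : L.g0) (m : M.carrier), ψ (M.act ↑x m) = W.act x (ψ m)) →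
    (∀ x ∈ L.gpos, ∀ m : M.carrier, ψ (M.act x m) = 0) →
    ∃! Φ : SHom M C, ∀ m, ε (Φ.toLin m) = ψ m

/-- `Coind_{𝔤≤0}^{𝔤}(W)`, by its universal property. -/
structure IsCoindNeg {L : GLSA} (W : SMod0 L) (C : SMod L) (ε : C.carrier →ₗ[ℂ] W.carrier) : Prop where
  map_ev : ∀ c ∈ C.ev, ε c ∈ W.ev
  map_od : ∀ c ∈ C.od, ε c ∈ W.od
  equivar : ∀ (x : L.g0) (c : C.carrier), ε (C.act ↑x c) = W.act x (ε c)
  neg_zero : ∀ x ∈ L.gneg, ∀ c : C.carrier, ε (C.act x c) = 0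
  universal : ∀ (M : SMod L) (ψ : M.carrier →ₗ[ℂ] W.carrier),
    (∀ m ∈ M.ev, ψ m ∈ W.ev) → (∀ m ∈ M.od, ψ m ∈ W.od) →
    (∀ (x : L.g0) (m : M.carrier), ψ (M.act ↑x m) = W.act x (ψ m)) →
    (∀ x ∈ L.gneg, ∀ m : M.carrier, ψ (M.act x m) = 0) →
    ∃! Φ : SHom M C, ∀ m, ε (Φ.toLin m) = ψ m

/-- The subspace `Λ^max(𝔤₋₁) ⊗ V ⊆ K(V)`: the span of all elements obtained by acting on
`η(V)` with `dim 𝔤₋₁` many elements of `𝔤₋₁`. -/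
def botPartNeg {L : GLSA} (V : SMod0 L) (K : SMod L) (η : V.carrier →ₗ[ℂ] K.carrier) :
    Submodule ℂ K.carrier :=
  Submodule.span ℂ {m | ∃ (xs : List L.carrier) (v : V.carrier),
    xs.length = finrank ℂ ↥L.gneg ∧ (∀ x ∈ xs, x ∈ L.gneg) ∧ m = K.actList xs (η v)}

/-- The subspace `Λ^max(𝔤₁) ⊗ V ⊆ K'(V)`. -/
def botPartPos {L : GLSA} (V : SMod0 L) (K : SMod L) (η : V.carrier →ₗ[ℂ] K.carrier) :
    Submodule ℂ K.carrier :=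
  Submodule.span ℂ {m | ∃ (xs : List L.carrier) (v : V.carrier),
    xs.length = finrank ℂ ↥L.gpos ∧ (∀ x ∈ xs, x ∈ L.gpos) ∧ m = K.actList xs (η v)}

/-- For `x ∈ 𝔤₀̄`, the operator `ad x` restricted to `𝔤₁`. -/
def adPos (L : GLSA) (x : L.g0) : ↥L.gpos →ₗ[ℂ] ↥L.gpos :=
  (L.bracket ↑x).restrict (fun y hy => L.br_0p ↑x x.2 y hy)

/-- For `x ∈ 𝔤₀̄`, the operator `ad x` restricted to `𝔤₋₁`. -/
def adNeg (L : GLSA) (x : L.g0) : ↥L.gneg →ₗ[ℂ] ↥L.gneg :=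
  (L.bracket ↑x).restrict (fun y hy => L.br_0n ↑x x.2 y hy)

/-- The character by which `𝔤₀̄` acts on the one-dimensional module `Λ^max(𝔤₁)`. -/
def traceCharPos (L : GLSA) (x : L.g0) : ℂ := LinearMap.trace ℂ ↥L.gpos (adPos L x)

/-- The character by which `𝔤₀̄` acts on the one-dimensional module `Λ^max(𝔤₋₁)`. -/
def traceCharNeg (L : GLSA) (x : L.g0) : ℂ := LinearMap.trace ℂ ↥L.gneg (adNeg L x)

/-- `IsTwistBy V W χ swap` expresses that `W ≅ ℂ_χ ⊗ V` as `𝔤₀̄`-supermodules, where `ℂ_χ`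
is the one-dimensional module with character `χ`, of odd parity iff `swap = true`.
Taking `χ` to be `traceCharPos`/`traceCharNeg` (resp. their negatives) and `swap` the parity
of `dim 𝔤±₁` expresses `W ≅ Λ^max(𝔤±₁) ⊗ V` (resp. `W ≅ Λ^max(𝔤±₁^*) ⊗ V`). -/
def IsTwistBy {L : GLSA} (V W : SMod0 L) (χ : ↥L.g0 → ℂ) (swap : Bool) : Prop :=
  ∃ e : V.carrier ≃ₗ[ℂ] W.carrier,
    (∀ (x : L.g0) (v : V.carrier), W.act x (e v) = e (V.act x v) + χ x • e v) ∧
    (if swap then (∀ v ∈ V.ev, e v ∈ W.od) ∧ (∀ v ∈ V.od, e v ∈ W.ev)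
     else (∀ v ∈ V.ev, e v ∈ W.ev) ∧ (∀ v ∈ V.od, e v ∈ W.od))

/-- Parity (as a `Bool`) of `dim 𝔤₁`. -/
def parPos (L : GLSA) : Bool := (finrank ℂ ↥L.gpos) % 2 == 1

/-- Parity (as a `Bool`) of `dim 𝔤₋₁`. -/
def parNeg (L : GLSA) : Bool := (finrank ℂ ↥L.gneg) % 2 == 1


section Exterior

open scoped TensorProduct

variable {N V : Type} [AddCommGroup N] [Module ℂ N] [AddCommGroup V] [Module ℂ V]

theorem ExteriorAlgebra.ι_mul_induction {C : ExteriorAlgebra ℂ N → Prop}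
    (one : C 1) (smul : ∀ (c : ℂ) a, C a → C (c • a)) (add : ∀ a b, C a → C b → C (a + b))
    (ι_mul : ∀ n a, C a → C (ExteriorAlgebra.ι ℂ n * a)) (a : ExteriorAlgebra ℂ N) : C a := by
  induction a using CliffordAlgebra.left_induction with
  | algebraMap r => rw [Algebra.algebraMap_eq_smul_one]; exact smul r 1 one
  | add x y hx hy => exact add x y hx hy
  | ι_mul x m hx => exact ι_mul m x hx

theorem ExteriorAlgebra.mul_ι_induction {C : ExteriorAlgebra ℂ N → Prop}
    (one : C 1) (smul : ∀ (c : ℂ) a, C a → C (c • a)) (add : ∀ a b, C a → C b → C (a + b))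
    (mul_ι : ∀ n a, C a → C (a * ExteriorAlgebra.ι ℂ n)) (a : ExteriorAlgebra ℂ N) : C a := by
  induction a using CliffordAlgebra.right_induction with
  | algebraMap r => rw [Algebra.algebraMap_eq_smul_one]; exact smul r 1 one
  | add x y hx hy => exact add x y hx hy
  | mul_ι m x hx => exact mul_ι m x hx

theorem ExteriorAlgebra.exists_recursion (f : N →ₗ[ℂ] ExteriorAlgebra ℂ N × V →ₗ[ℂ] V)
    (hf : ∀ n a y, f n (ExteriorAlgebra.ι ℂ n * a, f n (a, y)) = 0) (y : V) :
    ∃ F : ExteriorAlgebra ℂ N →ₗ[ℂ] V, F 1 = y ∧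
      ∀ n a, F (ExteriorAlgebra.ι ℂ n * a) = f n (a, F a) := by
  have hf' (n a y) : f n (CliffordAlgebra.ι (0 : QuadraticForm ℂ N) n * a, f n (a, y)) =
      (0 : QuadraticForm ℂ N) n • y := by
    rw [zero_apply, zero_smul]
    exact hf n a y
  refine ⟨CliffordAlgebra.foldr' (0 : QuadraticForm ℂ N) f hf' y, ?_,
    CliffordAlgebra.foldr'_ι_mul (0 : QuadraticForm ℂ N) f hf' y⟩
  rw [← map_one (algebraMap ℂ (ExteriorAlgebra ℂ N))]
  exact (CliffordAlgebra.foldr'_algebraMap _ f hf' y 1).trans (one_smul ℂ y)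

/-- Contraction of the exterior algebra along a linear form. -/
def contraction : Module.Dual ℂ N →ₗ[ℂ] ExteriorAlgebra ℂ N →ₗ[ℂ] ExteriorAlgebra ℂ N :=
  CliffordAlgebra.contractLeft (Q := (0 : QuadraticForm ℂ N))

theorem contraction_one (d : Module.Dual ℂ N) : contraction d 1 = 0 :=
  CliffordAlgebra.contractLeft_one (Q := (0 : QuadraticForm ℂ N)) d

theorem contraction_ι_mul (d : Module.Dual ℂ N) (n : N) (a : ExteriorAlgebra ℂ N) :
    contraction d (ExteriorAlgebra.ι ℂ n * a) =
      d n • a - ExteriorAlgebra.ι ℂ n * contraction d a :=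
  CliffordAlgebra.contractLeft_ι_mul (Q := (0 : QuadraticForm ℂ N)) d n a

/-- The automorphism of the exterior algebra multiplying the degree `k` part by `c ^ k`. -/
def dilation (c : ℂ) : ExteriorAlgebra ℂ N →ₐ[ℂ] ExteriorAlgebra ℂ N :=
  ExteriorAlgebra.map (c • LinearMap.id)

theorem dilation_ι_mul (c : ℂ) (n : N) (a : ExteriorAlgebra ℂ N) :
    dilation c (ExteriorAlgebra.ι ℂ n * a) = c • (ExteriorAlgebra.ι ℂ n * dilation c a) := by
  simp [dilation]

theorem contraction_dilation (d : Module.Dual ℂ N) (c : ℂ) (a : ExteriorAlgebra ℂ N) :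
    contraction d (dilation c a) = c • dilation c (contraction d a) := by
  induction a using ExteriorAlgebra.ι_mul_induction with
  | one => simp [contraction_one]
  | smul r a h => rw [map_smul, map_smul, h, map_smul, map_smul, smul_comm]
  | add a b ha hb => simp only [map_add, ha, hb, smul_add]
  | ι_mul n a h =>
    simp only [dilation_ι_mul, contraction_ι_mul, map_smul, map_sub, h, smul_sub, mul_smul_comm]

variable [FiniteDimensional ℂ N]

/-- The monomial basis of the exterior algebra. -/
def extBasis (N : Type) [AddCommGroup N] [Module ℂ N] [FiniteDimensional ℂ N] :
    Basis (Finset (Fin (finrank ℂ N))) ℂ (ExteriorAlgebra ℂ N) :=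
  (finBasis ℂ N).ExteriorAlgebra

/-- The coefficient of the top degree monomial. -/
def topCoeff (N : Type) [AddCommGroup N] [Module ℂ N] [FiniteDimensional ℂ N] :
    ExteriorAlgebra ℂ N →ₗ[ℂ] ℂ :=
  (extBasis N).coord Finset.univ

theorem dilation_extBasis (c : ℂ) (s : Finset (Fin (finrank ℂ N))) :
    dilation c (extBasis N s) = c ^ s.card • extBasis N s := by
  rw [extBasis, ExteriorAlgebra.basis_apply, dilation, ExteriorAlgebra.map_apply_ιMulti]
  have := (ExteriorAlgebra.ιMulti ℂ s.card).map_smul_univ (fun _ => c)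
    (finBasis ℂ N ∘ (Set.powersetCard.ofFinEmbEquiv.symm (Set.powersetCard.prodEquiv.symm s).2))
  rw [Finset.prod_const, Finset.card_univ, Fintype.card_fin] at this
  exact this

theorem topCoeff_dilation (c : ℂ) (a : ExteriorAlgebra ℂ N) :
    topCoeff N (dilation c a) = c ^ finrank ℂ N * topCoeff N a := by
  have : topCoeff N ∘ₗ (dilation c).toLinearMap = c ^ finrank ℂ N • topCoeff N := by
    refine (extBasis N).ext fun s => ?_
    rw [LinearMap.comp_apply, AlgHom.toLinearMap_apply, dilation_extBasis]
    by_cases hs : s = Finset.univ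
    · simp [hs]
    · simp [topCoeff, hs]
  exact congr($this a)

theorem topCoeff_mul_extBasis (s : Finset (Fin (finrank ℂ N))) :
    ∃ u : ℂ, u * u = 1 ∧
      ∀ t, topCoeff N (extBasis N t * extBasis N s) = if t = sᶜ then u else 0 := by
  have key : ∀ t, Disjoint t s → ∃ u : ℂ, u * u = 1 ∧
      extBasis N t * extBasis N s = u • extBasis N (t ∪ s) := by
    intro t h
    have h2 := ExteriorAlgebra.basis_mul_of_disjoint (finBasis ℂ N)
      (⟨t, rfl⟩ : Set.powersetCard _ t.card) (⟨s, rfl⟩ : Set.powersetCard _ s.card) h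
    rw [Set.powersetCard.coe_disjUnion, Finset.disjUnion_eq_union] at h2
    refine ⟨((Equiv.Perm.sign (Set.powersetCard.permOfDisjoint
      (s := (⟨t, rfl⟩ : Set.powersetCard _ t.card)) (t := ⟨s, rfl⟩) h) : ℤ) : ℂ), ?_, ?_⟩
    · rw [← Int.cast_mul, ← Units.val_mul, Int.units_mul_self]
      simp
    · rw [Int.cast_smul_eq_zsmul]
      exact h2
  have hcompl : ∀ t, topCoeff N (extBasis N t * extBasis N s) ≠ 0 → t = sᶜ := by
    intro t ht
    have h1 : Disjoint t s := by
      by_contra h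
      exact ht (by
        rw [extBasis, ExteriorAlgebra.basis_mul_of_not_disjoint (finBasis ℂ N)
          (⟨t, rfl⟩ : Set.powersetCard _ t.card) ⟨s, rfl⟩ h, map_zero])
    have h2 := key t h1
    rw [h2.choose_spec.2] at ht
    have h3 : t ∪ s = Finset.univ := by
      by_contra h
      simp [topCoeff, h] at ht
    exact (eq_compl_iff_isCompl.mpr ⟨h1, codisjoint_iff.mpr h3⟩)
  obtain ⟨u, hu, h⟩ := key sᶜ disjoint_compl_left
  refine ⟨u, hu, fun t => ?_⟩
  split_ifs with hts
  · rw [hts, h, ← Finset.sup_eq_union, compl_sup_eq_top]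
    simp [topCoeff]
  · by_contra hne
    exact hts (hcompl t hne)

/-- The derivation of the exterior algebra extending an endomorphism. -/
def extDer : (N →ₗ[ℂ] N) →ₗ[ℂ] ExteriorAlgebra ℂ N →ₗ[ℂ] ExteriorAlgebra ℂ N :=
  ∑ j, (LinearMap.lcomp ℂ (ExteriorAlgebra ℂ N) (contraction ((finBasis ℂ N).coord j))) ∘ₗ
    LinearMap.mul ℂ (ExteriorAlgebra ℂ N) ∘ₗ ExteriorAlgebra.ι ℂ ∘ₗ
    LinearMap.applyₗ (finBasis ℂ N j)

theorem extDer_apply (A : N →ₗ[ℂ] N) (a : ExteriorAlgebra ℂ N) :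
    extDer A a = ∑ j, ExteriorAlgebra.ι ℂ (A (finBasis ℂ N j)) *
      contraction ((finBasis ℂ N).coord j) a := by
  simp [extDer, LinearMap.sum_apply]

theorem extDer_one (A : N →ₗ[ℂ] N) : extDer A 1 = 0 := by
  simp [extDer_apply, contraction_one]

theorem extDer_ι_mul (A : N →ₗ[ℂ] N) (n : N) (a : ExteriorAlgebra ℂ N) :
    extDer A (ExteriorAlgebra.ι ℂ n * a) =
      ExteriorAlgebra.ι ℂ (A n) * a + ExteriorAlgebra.ι ℂ n * extDer A a := by
  have hA : A n = ∑ j, (finBasis ℂ N).coord j n • A (finBasis ℂ N j) := by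
    conv_lhs => rw [← (finBasis ℂ N).sum_repr n]
    rw [map_sum]
    simp only [map_smul, Basis.coord_apply]
  simp only [extDer_apply, contraction_ι_mul, hA, map_sum, map_smul, Finset.sum_mul,
    Finset.mul_sum, ← Finset.sum_add_distrib]
  refine Finset.sum_congr rfl fun j _ => ?_
  rw [mul_sub, ← mul_assoc, ← mul_assoc, mul_smul_comm, smul_mul_assoc,
    eq_neg_of_add_eq_zero_left (ExteriorAlgebra.ι_add_mul_swap _ n), neg_mul, sub_neg_eq_add]

theorem eq_zero_of_dilation (T : ExteriorAlgebra ℂ N →ₗ[ℂ] V)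
    (hT : ∀ a, T (dilation 2 a) = (2 : ℂ) ^ (finrank ℂ N + 1) • T a) : T = 0 := by
  refine (extBasis N).ext fun s => ?_
  have h := hT (extBasis N s)
  rw [dilation_extBasis, map_smul, ← sub_eq_zero, ← sub_smul] at h
  refine (smul_eq_zero.mp h).resolve_left (sub_ne_zero.mpr fun h' => ?_)
  have hs : s.card ≤ finrank ℂ N := by simpa using s.card_le_univ
  have : s.card = finrank ℂ N + 1 := Nat.pow_right_injective le_rfl (by exact_mod_cast h')
  omega

theorem topCoeff_contraction (d : Module.Dual ℂ N) (a : ExteriorAlgebra ℂ N) :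
    topCoeff N (contraction d a) = 0 := by
  refine congr($(eq_zero_of_dilation (topCoeff N ∘ₗ contraction d) fun a => ?_) a)
  simp only [LinearMap.comp_apply, contraction_dilation, map_smul, topCoeff_dilation, smul_eq_mul]
  ring

theorem topCoeff_extDer (A : N →ₗ[ℂ] N) (a : ExteriorAlgebra ℂ N) :
    topCoeff N (extDer A a) = LinearMap.trace ℂ N A * topCoeff N a := by
  have h (j) : ExteriorAlgebra.ι ℂ (A (finBasis ℂ N j)) * contraction ((finBasis ℂ N).coord j) a =
      (finBasis ℂ N).coord j (A (finBasis ℂ N j)) • a -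
        contraction ((finBasis ℂ N).coord j) (ExteriorAlgebra.ι ℂ (A (finBasis ℂ N j)) * a) := by
    rw [contraction_ι_mul, sub_sub_cancel]
  simp only [extDer_apply, h, map_sum, map_sub, topCoeff_contraction, sub_zero, map_smul,
    smul_eq_mul, ← Finset.sum_mul]
  rw [LinearMap.trace_eq_matrix_trace ℂ (finBasis ℂ N)]
  simp [Matrix.trace, LinearMap.toMatrix_apply]

/-- Left multiplication on the free module `Λ(N) ⊗ V`. -/
def wedge (V : Type) [AddCommGroup V] [Module ℂ V] :
    ExteriorAlgebra ℂ N →ₗ[ℂ] ExteriorAlgebra ℂ N ⊗[ℂ] V →ₗ[ℂ] ExteriorAlgebra ℂ N ⊗[ℂ] V :=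
  LinearMap.rTensorHom V ∘ₗ LinearMap.mul ℂ (ExteriorAlgebra ℂ N)

omit [FiniteDimensional ℂ N] in
@[simp]
theorem wedge_tmul (a b : ExteriorAlgebra ℂ N) (v : V) :
    wedge V a (b ⊗ₜ v) = (a * b) ⊗ₜ v := rfl

omit [FiniteDimensional ℂ N] in
theorem wedge_one : wedge V (1 : ExteriorAlgebra ℂ N) = LinearMap.id :=
  TensorProduct.ext' fun a v => by rw [wedge_tmul, one_mul, LinearMap.id_apply]

omit [FiniteDimensional ℂ N] in
theorem wedge_mul (a b : ExteriorAlgebra ℂ N) : wedge V (a * b) = wedge V a ∘ₗ wedge V b :=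
  TensorProduct.ext' fun c v => by
    rw [LinearMap.comp_apply, wedge_tmul, wedge_tmul, wedge_tmul, mul_assoc]

/-- The projection of `Λ(N) ⊗ V` onto its top degree component, identified with `V`. -/
def topProj (N V : Type) [AddCommGroup N] [Module ℂ N] [FiniteDimensional ℂ N]
    [AddCommGroup V] [Module ℂ V] : ExteriorAlgebra ℂ N ⊗[ℂ] V →ₗ[ℂ] V :=
  TensorProduct.lid ℂ V ∘ₗ (topCoeff N).rTensor V

@[simp]
theorem topProj_tmul (a : ExteriorAlgebra ℂ N) (v : V) :
    topProj N V (a ⊗ₜ v) = topCoeff N a • v := by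
  simp [topProj]

theorem eq_zero_of_topProj_wedge (x : ExteriorAlgebra ℂ N ⊗[ℂ] V)
    (hx : ∀ a, topProj N V (wedge V a x) = 0) : x = 0 := by
  obtain ⟨c, rfl⟩ := TensorProduct.eq_repr_basis_left (extBasis N) x
  suffices c = 0 by simp [this]
  ext s
  obtain ⟨u, hu, h⟩ := topCoeff_mul_extBasis s
  have h1 := hx (extBasis N sᶜ)
  rw [Finsupp.sum_fintype _ _ (by simp), map_sum, map_sum, Finset.sum_eq_single s] at h1
  · rw [wedge_tmul, topProj_tmul, h, if_pos rfl] at h1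
    simpa [smul_smul, hu] using congr(u • $h1)
  · intro t _ hts
    obtain ⟨u', _, h'⟩ := topCoeff_mul_extBasis t
    rw [wedge_tmul, topProj_tmul, h', if_neg (fun h => hts (compl_injective h.symm)), zero_smul]
  · simp

theorem exists_topProj_wedge (f : ExteriorAlgebra ℂ N →ₗ[ℂ] V) :
    ∃ x : ExteriorAlgebra ℂ N ⊗[ℂ] V, ∀ a, topProj N V (wedge V a x) = f a := by
  choose u hu h using topCoeff_mul_extBasis (N := N)
  let x := ∑ s, extBasis N s ⊗ₜ[ℂ] (u s • f (extBasis N sᶜ))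
  refine ⟨x, fun a => ?_⟩
  suffices topProj N V ∘ₗ (wedge V).flip x = f from congr($this a)
  refine (extBasis N).ext fun t => ?_
  rw [LinearMap.comp_apply, LinearMap.flip_apply, map_sum, map_sum, Finset.sum_eq_single tᶜ]
  · rw [wedge_tmul, topProj_tmul, h, if_pos (compl_compl t).symm, smul_smul, hu, one_smul,
      compl_compl]
  · intro s _ hst
    rw [wedge_tmul, topProj_tmul, h, if_neg, zero_smul]
    rintro rfl
    exact hst (compl_compl s).symm
  · simp

end Exterior

section Parity

variable {V W : Type} [AddCommGroup V] [Module ℂ V] [AddCommGroup W] [Module ℂ W]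

theorem exists_parity {ev od : Submodule ℂ V} (h : IsCompl ev od) :
    ∃ σ : V →ₗ[ℂ] V, (∀ v, v ∈ ev ↔ σ v = v) ∧ ∀ v, v ∈ od ↔ σ v = -v := by
  have : IsAddTorsionFree V := .of_isTorsionFree ℂ V
  have key (v : V) : ∃ a ∈ ev, ∃ b ∈ od, a + b = v :=
    Submodule.mem_sup.mp (h.sup_eq_top ▸ Submodule.mem_top)
  let σ := LinearMap.ofIsCompl h ev.subtype (-od.subtype)
  have h1 {v} (hv : v ∈ ev) : σ v = v := LinearMap.ofIsCompl_apply_left h ⟨v, hv⟩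
  have h2 {v} (hv : v ∈ od) : σ v = -v := LinearMap.ofIsCompl_apply_right h ⟨v, hv⟩
  refine ⟨σ, fun v => ⟨h1, fun hv => ?_⟩, fun v => ⟨h2, fun hv => ?_⟩⟩ <;>
    obtain ⟨a, ha, b, hb, rfl⟩ := key v <;> rw [map_add, h1 ha, h2 hb] at hv
  · have : b = 0 := by
      rw [add_right_inj, neg_eq_self] at hv; exact hv
    simpa [this] using ha
  · have : a = 0 := by
      rw [neg_add, add_left_inj, self_eq_neg] at hv; exact hv
    simpa [this] using hb

/-- The parity involution of a graded space. -/
def parity {ev od : Submodule ℂ V} (h : IsCompl ev od) : V →ₗ[ℂ] V := (exists_parity h).choose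

theorem mem_even_iff {ev od : Submodule ℂ V} (h : IsCompl ev od) (v : V) :
    v ∈ ev ↔ parity h v = v := (exists_parity h).choose_spec.1 v

theorem mem_odd_iff {ev od : Submodule ℂ V} (h : IsCompl ev od) (v : V) :
    v ∈ od ↔ parity h v = -v := (exists_parity h).choose_spec.2 v

theorem parity_parity {ev od : Submodule ℂ V} (h : IsCompl ev od) (v : V) :
    parity h (parity h v) = v := by
  obtain ⟨a, ha, b, hb, rfl⟩ : ∃ a ∈ ev, ∃ b ∈ od, a + b = v :=
    Submodule.mem_sup.mp (h.sup_eq_top ▸ Submodule.mem_top)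
  rw [map_add, (mem_even_iff h a).mp ha, (mem_odd_iff h b).mp hb, map_add, map_neg,
    (mem_even_iff h a).mp ha, (mem_odd_iff h b).mp hb, neg_neg]

theorem map_parity {ev od : Submodule ℂ V} (h : IsCompl ev od) {ev' od' : Submodule ℂ W}
    (h' : IsCompl ev' od') (T : V →ₗ[ℂ] W) (he : ∀ v ∈ ev, T v ∈ ev') (ho : ∀ v ∈ od, T v ∈ od')
    (v : V) : T (parity h v) = parity h' (T v) := by
  obtain ⟨a, ha, b, hb, rfl⟩ : ∃ a ∈ ev, ∃ b ∈ od, a + b = v :=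
    Submodule.mem_sup.mp (h.sup_eq_top ▸ Submodule.mem_top)
  rw [map_add, (mem_even_iff h a).mp ha, (mem_odd_iff h b).mp hb, map_add, map_add, map_add,
    (mem_even_iff h' _).mp (he a ha), (mem_odd_iff h' _).mp (ho b hb), map_neg]

theorem map_parity_of_swap {ev od : Submodule ℂ V} (h : IsCompl ev od) {ev' od' : Submodule ℂ W}
    (h' : IsCompl ev' od') (T : V →ₗ[ℂ] W) (he : ∀ v ∈ ev, T v ∈ od') (ho : ∀ v ∈ od, T v ∈ ev')
    (v : V) : T (parity h v) = -parity h' (T v) := by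
  obtain ⟨a, ha, b, hb, rfl⟩ : ∃ a ∈ ev, ∃ b ∈ od, a + b = v :=
    Submodule.mem_sup.mp (h.sup_eq_top ▸ Submodule.mem_top)
  rw [map_add, (mem_even_iff h a).mp ha, (mem_odd_iff h b).mp hb, map_add, map_add, map_add,
    (mem_odd_iff h' _).mp (he a ha), (mem_even_iff h' _).mp (ho b hb), map_neg]
  abel

theorem map_even {ev od : Submodule ℂ V} (h : IsCompl ev od) {ev' od' : Submodule ℂ W}
    (h' : IsCompl ev' od') {T : V →ₗ[ℂ] W} (hT : ∀ v, T (parity h v) = parity h' (T v))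
    {v : V} (hv : v ∈ ev) : T v ∈ ev' := by
  rw [mem_even_iff h', ← hT, (mem_even_iff h v).mp hv]

theorem map_odd {ev od : Submodule ℂ V} (h : IsCompl ev od) {ev' od' : Submodule ℂ W}
    (h' : IsCompl ev' od') {T : V →ₗ[ℂ] W} (hT : ∀ v, T (parity h v) = parity h' (T v))
    {v : V} (hv : v ∈ od) : T v ∈ od' := by
  rw [mem_odd_iff h', ← hT, (mem_odd_iff h v).mp hv, map_neg]

theorem isCompl_of_involution (θ : V →ₗ[ℂ] V) (hθ : ∀ v, θ (θ v) = v) :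
    IsCompl (LinearMap.eqLocus θ LinearMap.id) (LinearMap.eqLocus θ (-LinearMap.id)) := by
  have : IsAddTorsionFree V := .of_isTorsionFree ℂ V
  constructor
  · rw [Submodule.disjoint_def]
    intro v h1 h2
    simp only [LinearMap.mem_eqLocus, LinearMap.id_apply, LinearMap.neg_apply] at h1 h2
    exact self_eq_neg.mp (h1.symm.trans h2)
  · rw [codisjoint_iff, eq_top_iff]
    intro v _
    refine Submodule.mem_sup.mpr ⟨(2⁻¹ : ℂ) • (v + θ v), ?_, (2⁻¹ : ℂ) • (v - θ v), ?_, ?_⟩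
    · simp [hθ, add_comm]
    · simp [hθ]
    · rw [← smul_add]
      have : v + θ v + (v - θ v) = (2 : ℂ) • v := by rw [two_smul]; abel
      rw [this, smul_smul]; simp

end Parity

/-- A decomposition `𝔤₁̄ = N ⊕ P` of the odd part satisfying the axioms of a compatible
`ℤ`-grading with `N` and `P` in degrees `-1` and `1` (in either order). -/
structure IsPolarization (L : GLSA) (N P : Submodule ℂ L.carrier) : Prop where
  sup_eq : N ⊔ P = L.odd
  disj : Disjoint N P
  br_0N : ∀ x ∈ L.g0, ∀ y ∈ N, L.bracket x y ∈ N
  br_0P : ∀ x ∈ L.g0, ∀ y ∈ P, L.bracket x y ∈ P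
  br_PN : ∀ x ∈ P, ∀ y ∈ N, L.bracket x y ∈ L.g0
  br_NN : ∀ x ∈ N, ∀ y ∈ N, L.bracket x y = 0
  br_PP : ∀ x ∈ P, ∀ y ∈ P, L.bracket x y = 0

theorem isPolarization_neg_pos (L : GLSA) : IsPolarization L L.gneg L.gpos where
  sup_eq := rfl
  disj := L.disjNP
  br_0N := L.br_0n
  br_0P := L.br_0p
  br_PN := L.br_pn
  br_NN := L.br_nn
  br_PP := L.br_pp

theorem IsPolarization.symm {L : GLSA} {N P : Submodule ℂ L.carrier} (h : IsPolarization L N P) :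
    IsPolarization L P N where
  sup_eq := sup_comm N P ▸ h.sup_eq
  disj := h.disj.symm
  br_0N := h.br_0P
  br_0P := h.br_0N
  br_PN x hx y hy := by
    have hle : N ⊔ P ≤ L.odd := h.sup_eq.le
    rw [L.skew_oo x (hle (Submodule.mem_sup_left hx)) y (hle (Submodule.mem_sup_right hy))]
    exact h.br_PN y hy x hx
  br_NN := h.br_PP
  br_PP := h.br_NN

theorem isPolarization_pos_neg (L : GLSA) : IsPolarization L L.gpos L.gneg :=
  (isPolarization_neg_pos L).symm

/-- The even `𝔤₀`-equivariant maps from `V` to a `𝔤`-supermodule with image killed by `P`. -/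
structure IsInvariantMap {L : GLSA} (P : Submodule ℂ L.carrier) (V : SMod0 L) (K : SMod L)
    (η : V.carrier →ₗ[ℂ] K.carrier) : Prop where
  map_ev : ∀ v ∈ V.ev, η v ∈ K.ev
  map_od : ∀ v ∈ V.od, η v ∈ K.od
  equivar : ∀ (x : L.g0) (v : V.carrier), η (V.act x v) = K.act ↑x (η v)
  zero : ∀ x ∈ P, ∀ v : V.carrier, K.act x (η v) = 0

/-- The even `𝔤₀`-equivariant maps from a `𝔤`-supermodule to `W` killing the image of `P`. -/
structure IsCoinvariantMap {L : GLSA} (P : Submodule ℂ L.carrier) (W : SMod0 L) (C : SMod L)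
    (ε : C.carrier →ₗ[ℂ] W.carrier) : Prop where
  map_ev : ∀ c ∈ C.ev, ε c ∈ W.ev
  map_od : ∀ c ∈ C.od, ε c ∈ W.od
  equivar : ∀ (x : L.g0) (c : C.carrier), ε (C.act ↑x c) = W.act x (ε c)
  zero : ∀ x ∈ P, ∀ c : C.carrier, ε (C.act x c) = 0

theorem SHom.ext {L : GLSA} {M N : SMod L} {f g : SHom M N} (h : ∀ m, f.toLin m = g.toLin m) :
    f = g := by
  cases f; cases g
  congr
  exact LinearMap.ext h

/-- The identity homomorphism. -/
def SHom.id {L : GLSA} (M : SMod L) : SHom M M where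
  toLin := LinearMap.id
  map_ev _ h := h
  map_od _ h := h
  equivar _ _ := rfl

/-- Composition of homomorphisms. -/
def SHom.comp {L : GLSA} {M N K : SMod L} (g : SHom N K) (f : SHom M N) : SHom M K where
  toLin := g.toLin ∘ₗ f.toLin
  map_ev m h := g.map_ev _ (f.map_ev m h)
  map_od m h := g.map_od _ (f.map_od m h)
  equivar x m := by simp [f.equivar, g.equivar]

theorem SHom.comp_apply {L : GLSA} {M N K : SMod L} (g : SHom N K) (f : SHom M N)
    (m : M.carrier) : (g.comp f).toLin m = g.toLin (f.toLin m) := rfl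

/-- A homomorphism from an equivariant linear map commuting with the parity involutions. -/
def SHom.mk' {L : GLSA} {M N : SMod L} (T : M.carrier →ₗ[ℂ] N.carrier)
    (hσ : ∀ m, T (parity M.grading m) = parity N.grading (T m))
    (hact : ∀ x m, T (M.act x m) = N.act x (T m)) : SHom M N where
  toLin := T
  map_ev _ h := map_even M.grading N.grading hσ h
  map_od _ h := map_odd M.grading N.grading hσ h
  equivar := hact

namespace IsPolarization

variable {L : GLSA} {N P : Submodule ℂ L.carrier} (h : IsPolarization L N P)

include h

theorem left_le : N ≤ L.odd := h.sup_eq ▸ le_sup_left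

theorem right_le : P ≤ L.odd := h.sup_eq ▸ le_sup_right

theorem exists_decomp (x : L.carrier) : ∃ g ∈ L.g0, ∃ n ∈ N, ∃ p ∈ P, g + (n + p) = x := by
  have hx : x ∈ L.g0 ⊔ (N ⊔ P) := by
    rw [h.sup_eq, GLSA.odd, L.oddCompl.sup_eq_top]; trivial
  obtain ⟨g, hg, y, hy, rfl⟩ := Submodule.mem_sup.mp hx
  obtain ⟨n, hn, p, hp, rfl⟩ := Submodule.mem_sup.mp hy
  exact ⟨g, hg, n, hn, p, hp, rfl⟩

/-- The adjoint action of `𝔤₀` on `N`. -/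
def ad (x : L.g0) : N →ₗ[ℂ] N :=
  (L.bracket ↑x).restrict (fun y hy => h.br_0N ↑x x.2 y hy)

omit h in
theorem coe_ad (h : IsPolarization L N P) (x : L.g0) (n : N) :
    (h.ad x n : L.carrier) = L.bracket x n := rfl

/-- The action of `Λ(N) = U(N)` on a `𝔤`-supermodule. -/
def extAct (M : SMod L) : ExteriorAlgebra ℂ N →ₐ[ℂ] End ℂ M.carrier :=
  ExteriorAlgebra.lift ℂ ⟨M.act ∘ₗ N.subtype, fun n => by
    have : IsAddTorsionFree M.carrier := .of_isTorsionFree ℂ M.carrier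
    ext m
    have := M.act_br_oo n (h.left_le n.2) n (h.left_le n.2) m
    rw [h.br_NN _ n.2 _ n.2, map_zero, LinearMap.zero_apply] at this
    exact self_eq_neg.mp (eq_neg_of_add_eq_zero_left this.symm)⟩

theorem extAct_ι (M : SMod L) (n : N) : h.extAct M (ExteriorAlgebra.ι ℂ n) = M.act n := by
  simp [extAct]

theorem extAct_ι_mul (M : SMod L) (n : N) (a : ExteriorAlgebra ℂ N) (m : M.carrier) :
    h.extAct M (ExteriorAlgebra.ι ℂ n * a) m = M.act n (h.extAct M a m) := by
  rw [map_mul, Module.End.mul_apply, extAct_ι]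

theorem extAct_mul_ι (M : SMod L) (n : N) (a : ExteriorAlgebra ℂ N) (m : M.carrier) :
    h.extAct M (a * ExteriorAlgebra.ι ℂ n) m = h.extAct M a (M.act n m) := by
  rw [map_mul, Module.End.mul_apply, extAct_ι]

theorem act_extAct [FiniteDimensional ℂ N] (M : SMod L) (g : L.g0) (a : ExteriorAlgebra ℂ N)
    (m : M.carrier) : M.act g (h.extAct M a m) =
      h.extAct M (extDer (h.ad g) a) m + h.extAct M a (M.act g m) := by
  induction a using ExteriorAlgebra.ι_mul_induction with
  | one => simp [extDer_one]
  | smul r a ha => simp [ha]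
  | add a b ha hb => simp only [map_add, LinearMap.add_apply, ha, hb]; abel
  | ι_mul n a ha =>
    have := M.act_br_e g n (.inl g.2) (h.extAct M a m)
    rw [eq_sub_iff_add_eq] at this
    simp only [extDer_ι_mul, map_add, LinearMap.add_apply, extAct_ι_mul, coe_ad, ← this, ha]
    abel

omit h in
theorem parity_act_odd (M : SMod L) {x : L.carrier} (hx : x ∈ L.odd) (m : M.carrier) :
    M.act x (parity M.grading m) = -parity M.grading (M.act x m) :=
  map_parity_of_swap M.grading M.grading (M.act x) (M.act_o_ev x hx) (M.act_o_od x hx) m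

theorem extAct_parity (M : SMod L) (a : ExteriorAlgebra ℂ N) (m : M.carrier) :
    h.extAct M a (parity M.grading m) = parity M.grading (h.extAct M (dilation (-1) a) m) := by
  induction a using ExteriorAlgebra.ι_mul_induction with
  | one => simp
  | smul r a ha => simp [ha]
  | add a b ha hb => simp only [map_add, LinearMap.add_apply, ha, hb]
  | ι_mul n a ha =>
    rw [extAct_ι_mul, ha, parity_act_odd M (h.left_le n.2), dilation_ι_mul, map_smul,
      LinearMap.smul_apply, extAct_ι_mul, map_smul, neg_one_smul]

theorem toLin_extAct {M X : SMod L} (Φ : SHom M X) (a : ExteriorAlgebra ℂ N) (m : M.carrier) :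
    Φ.toLin (h.extAct M a m) = h.extAct X a (Φ.toLin m) := by
  induction a using ExteriorAlgebra.ι_mul_induction with
  | one => simp
  | smul r a ha => simp [ha]
  | add a b ha hb => simp [ha, hb]
  | ι_mul n a ha => rw [extAct_ι_mul, extAct_ι_mul, Φ.equivar, ha]

section Pairing

variable {W : SMod0 L} {X M : SMod L} {ε : X.carrier →ₗ[ℂ] W.carrier}
  {ψ : M.carrier →ₗ[ℂ] W.carrier}

theorem pairing_act_left {x : X.carrier} {m : M.carrier}
    (hxm : ∀ a, ε (h.extAct X a x) = ψ (h.extAct M a m)) (n : N) (a : ExteriorAlgebra ℂ N) :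
    ε (h.extAct X a (X.act n x)) = ψ (h.extAct M a (M.act n m)) := by
  rw [← extAct_mul_ι, ← extAct_mul_ι, hxm]

theorem pairing_act_zero [FiniteDimensional ℂ N] (hε : IsCoinvariantMap P W X ε)
    (hψ : IsCoinvariantMap P W M ψ) {x : X.carrier} {m : M.carrier}
    (hxm : ∀ a, ε (h.extAct X a x) = ψ (h.extAct M a m)) (g : L.g0) (a : ExteriorAlgebra ℂ N) :
    ε (h.extAct X a (X.act g x)) = ψ (h.extAct M a (M.act g m)) := by
  rw [← sub_eq_iff_eq_add'.mpr (h.act_extAct X g a x),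
    ← sub_eq_iff_eq_add'.mpr (h.act_extAct M g a m), map_sub, map_sub, hε.equivar, hψ.equivar,
    hxm, hxm]

theorem pairing_act_right [FiniteDimensional ℂ N] (hε : IsCoinvariantMap P W X ε)
    (hψ : IsCoinvariantMap P W M ψ) {x : X.carrier} {m : M.carrier}
    (hxm : ∀ a, ε (h.extAct X a x) = ψ (h.extAct M a m)) {p : L.carrier} (hp : p ∈ P)
    (a : ExteriorAlgebra ℂ N) :
    ε (h.extAct X a (X.act p x)) = ψ (h.extAct M a (M.act p m)) := by
  induction a using ExteriorAlgebra.mul_ι_induction generalizing x m with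
  | one => simp [hε.zero p hp, hψ.zero p hp]
  | smul r a ha => simp [ha hxm]
  | add a b ha hb => simp [ha hxm, hb hxm]
  | mul_ι n a ha =>
    have key (S : SMod L) (s : S.carrier) : S.act n (S.act p s) =
        S.act (⟨L.bracket p n, h.br_PN p hp n n.2⟩ : L.g0) s - S.act p (S.act n s) := by
      rw [eq_sub_iff_add_eq', ← S.act_br_oo p (h.right_le hp) n (h.left_le n.2)]
    rw [extAct_mul_ι, extAct_mul_ι, key, key, map_sub, map_sub, map_sub, map_sub,
      h.pairing_act_zero hε hψ hxm, ha (h.pairing_act_left hxm n)]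

theorem pairing_act [FiniteDimensional ℂ N] (hε : IsCoinvariantMap P W X ε)
    (hψ : IsCoinvariantMap P W M ψ) {x : X.carrier} {m : M.carrier}
    (hxm : ∀ a, ε (h.extAct X a x) = ψ (h.extAct M a m)) (y : L.carrier)
    (a : ExteriorAlgebra ℂ N) :
    ε (h.extAct X a (X.act y x)) = ψ (h.extAct M a (M.act y m)) := by
  obtain ⟨g, hg, n, hn, p, hp, rfl⟩ := h.exists_decomp y
  simp only [map_add, LinearMap.add_apply]
  rw [h.pairing_act_zero hε hψ hxm ⟨g, hg⟩, h.pairing_act_left hxm ⟨n, hn⟩,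
    h.pairing_act_right hε hψ hxm hp]

theorem pairing_parity (hε : IsCoinvariantMap P W X ε)
    (hψ : IsCoinvariantMap P W M ψ) {x : X.carrier} {m : M.carrier}
    (hxm : ∀ a, ε (h.extAct X a x) = ψ (h.extAct M a m)) (a : ExteriorAlgebra ℂ N) :
    ε (h.extAct X a (parity X.grading x)) = ψ (h.extAct M a (parity M.grading m)) := by
  rw [extAct_parity, extAct_parity, map_parity X.grading W.grading ε hε.map_ev hε.map_od,
    map_parity M.grading W.grading ψ hψ.map_ev hψ.map_od, hxm]

/-- A coinvariant map inducing a perfect pairing with `Λ(N)` exhibits a coinduced module. -/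
theorem existsUnique_lift [FiniteDimensional ℂ N] (hε : IsCoinvariantMap P W X ε)
    (hperf : ∀ f : ExteriorAlgebra ℂ N →ₗ[ℂ] W.carrier, ∃ x, ∀ a, ε (h.extAct X a x) = f a)
    (hinj : ∀ x, (∀ a, ε (h.extAct X a x) = 0) → x = 0)
    (hψ : IsCoinvariantMap P W M ψ) : ∃! Φ : SHom M X, ∀ m, ε (Φ.toLin m) = ψ m := by
  have hex (m : M.carrier) : ∃ x, ∀ a, ε (h.extAct X a x) = ψ (h.extAct M a m) :=
    hperf (ψ ∘ₗ (h.extAct M).toLinearMap.flip m)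
  have huniq {x y : X.carrier} (hxy : ∀ a, ε (h.extAct X a x) = ε (h.extAct X a y)) : x = y :=
    sub_eq_zero.mp (hinj _ fun a => by rw [map_sub, map_sub, hxy, sub_self])
  choose T hT using hex
  refine ⟨SHom.mk' { toFun := T, map_add' := fun m m' => ?_, map_smul' := fun c m => ?_ }
    (fun m => ?_) (fun x m => ?_), fun m => ?_, fun Φ hΦ => SHom.ext fun m => huniq fun a => ?_⟩
  · exact huniq fun a => by simp [hT]
  · exact huniq fun a => by simp [hT]
  · exact huniq fun a => (hT _ a).trans (h.pairing_parity hε hψ (hT m) a).symm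
  · exact huniq fun a => (hT _ a).trans (h.pairing_act hε hψ (hT m) x a).symm
  · have := hT m 1
    rwa [map_one, map_one] at this
  · rw [← toLin_extAct, hΦ]
    exact (hT m a).symm

end Pairing

end IsPolarization

section Model

open scoped TensorProduct

theorem tmul_wedge_induction {N V : Type} [AddCommGroup N] [Module ℂ N] [AddCommGroup V]
    [Module ℂ V] {C : ExteriorAlgebra ℂ N ⊗[ℂ] V → Prop} (one : ∀ v, C (1 ⊗ₜ v))
    (add : ∀ x y, C x → C y → C (x + y))
    (wedge : ∀ n x, C x → C (wedge V (ExteriorAlgebra.ι ℂ n) x))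
    (x : ExteriorAlgebra ℂ N ⊗[ℂ] V) : C x := by
  induction x using TensorProduct.induction_on with
  | zero => simpa using one 0
  | add x y hx hy => exact add x y hx hy
  | tmul a v =>
    induction a using ExteriorAlgebra.ι_mul_induction generalizing v with
    | one => exact one v
    | smul c a ha => rw [TensorProduct.smul_tmul]; exact ha _
    | add a b ha hb => rw [TensorProduct.add_tmul]; exact add _ _ (ha v) (hb v)
    | ι_mul n a ha => exact wedge n _ (ha v)

namespace IsPolarization

variable {L : GLSA} {N P : Submodule ℂ L.carrier} (h : IsPolarization L N P)

/-- The bracket `P × N → 𝔤₀`. -/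
def brPN : P →ₗ[ℂ] N →ₗ[ℂ] L.g0 :=
  LinearMap.mk₂ ℂ (fun p n => ⟨L.bracket p n, h.br_PN p p.2 n n.2⟩)
    (fun _ _ _ => by ext; simp) (fun _ _ _ => by ext; simp)
    (fun _ _ _ => by ext; simp) (fun _ _ _ => by ext; simp)

theorem coe_brPN (p : P) (n : N) : (h.brPN p n : L.carrier) = L.bracket p n := rfl

theorem ad_brPN_self (p : P) (n : N) : h.ad (h.brPN p n) n = 0 := by
  have : IsAddTorsionFree L.carrier := .of_isTorsionFree ℂ L.carrier
  have hn := h.left_le n.2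
  have hp := h.right_le p.2
  have key := L.jacobi_oo n hn n hn p
  rw [h.br_NN n n.2 n n.2, map_zero, LinearMap.zero_apply, zero_sub, self_eq_neg,
    L.skew_oo n hn p hp] at key
  ext
  rw [coe_ad, L.skew_e _ (h.brPN p n).2, coe_brPN, key, neg_zero, Submodule.coe_zero]

theorem bracket_bracket_left (g g' : L.g0) (n : N) :
    h.ad ⟨L.bracket g g', L.br_00 g g.2 g' g'.2⟩ n = h.ad g (h.ad g' n) - h.ad g' (h.ad g n) := by
  ext
  rw [Submodule.coe_sub, coe_ad, coe_ad, coe_ad, coe_ad, coe_ad,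
    L.jacobi_e g g' n (.inl g.2), add_sub_cancel_right]

theorem brPN_ad (g : L.g0) (p : P) (n : N) :
    h.brPN (h.symm.ad g p) n + h.brPN p (h.ad g n) =
      ⟨L.bracket g (h.brPN p n), L.br_00 g g.2 _ (h.brPN p n).2⟩ := by
  ext
  exact (L.jacobi_e g p n (.inl g.2)).symm

theorem ad_brPN_add (p q : P) (n : N) :
    h.symm.ad (h.brPN q n) p + h.symm.ad (h.brPN p n) q = 0 := by
  ext
  have := L.jacobi_oo p (h.right_le p.2) q (h.right_le q.2) n
  rw [h.br_PP p p.2 q q.2, map_zero, LinearMap.zero_apply, zero_sub] at this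
  rw [Submodule.coe_add, coe_ad, coe_ad, L.skew_e _ (h.brPN q n).2, L.skew_e _ (h.brPN p n).2,
    coe_brPN, coe_brPN, this]
  simp

/-- The decomposition `𝔤 = 𝔤₀ ⊕ N ⊕ P`. -/
def decomp : (L.g0 × N × P) ≃ₗ[ℂ] L.carrier :=
  .ofBijective (L.g0.subtype.coprod (N.subtype.coprod P.subtype)) <| by
    constructor
    · rw [← LinearMap.ker_eq_bot, LinearMap.ker_eq_bot']
      rintro ⟨g, n, p⟩ hx
      simp only [LinearMap.coprod_apply, Submodule.subtype_apply] at hx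
      have hnp : (n + p : L.carrier) ∈ L.odd := add_mem (h.left_le n.2) (h.right_le p.2)
      have hg : (g : L.carrier) = 0 := by
        refine Submodule.disjoint_def.mp L.oddCompl.disjoint g g.2 ?_
        rw [eq_neg_of_add_eq_zero_left hx]
        exact neg_mem hnp
      rw [hg, zero_add] at hx
      have hn : (n : L.carrier) = 0 := by
        refine Submodule.disjoint_def.mp h.disj n n.2 ?_
        rw [eq_neg_of_add_eq_zero_left hx]
        exact neg_mem p.2
      rw [hn, zero_add] at hx
      ext <;> assumption
    · intro x
      obtain ⟨g, hg, n, hn, p, hp, rfl⟩ := h.exists_decomp x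
      exact ⟨(⟨g, hg⟩, ⟨n, hn⟩, ⟨p, hp⟩), rfl⟩

variable [FiniteDimensional ℂ N] (V : SMod0 L)

/-- The action of `𝔤₀` on `Λ(N) ⊗ V`. -/
def zeroAct : L.g0 →ₗ[ℂ] End ℂ (ExteriorAlgebra ℂ N ⊗[ℂ] V.carrier) where
  toFun g := (extDer (h.ad g)).rTensor V.carrier + (V.act g).lTensor _
  map_add' g g' := by
    have : h.ad (g + g') = h.ad g + h.ad g' := by ext; simp [coe_ad]
    rw [this, map_add, map_add, LinearMap.rTensor_add, LinearMap.lTensor_add]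
    abel
  map_smul' c g := by
    have : h.ad (c • g) = c • h.ad g := by ext; simp [coe_ad]
    rw [this, map_smul, map_smul, LinearMap.rTensor_smul, LinearMap.lTensor_smul]
    simp

theorem zeroAct_tmul (g : L.g0) (a : ExteriorAlgebra ℂ N) (v : V.carrier) :
    h.zeroAct V g (a ⊗ₜ v) = extDer (h.ad g) a ⊗ₜ v + a ⊗ₜ V.act g v := rfl

theorem zeroAct_one_tmul (g : L.g0) (v : V.carrier) :
    h.zeroAct V g (1 ⊗ₜ v) = 1 ⊗ₜ V.act g v := by
  rw [zeroAct_tmul, extDer_one, TensorProduct.zero_tmul, zero_add]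

omit [FiniteDimensional ℂ N] in
theorem wedge_ι_wedge_ι (n n' : N) (x : ExteriorAlgebra ℂ N ⊗[ℂ] V.carrier) :
    wedge V.carrier (ExteriorAlgebra.ι ℂ n) (wedge V.carrier (ExteriorAlgebra.ι ℂ n') x) =
      -wedge V.carrier (ExteriorAlgebra.ι ℂ n') (wedge V.carrier (ExteriorAlgebra.ι ℂ n) x) := by
  induction x using TensorProduct.induction_on with
  | zero => simp
  | add x y hx hy => simp only [map_add, hx, hy, neg_add]
  | tmul a v =>
    rw [wedge_tmul, wedge_tmul, wedge_tmul, wedge_tmul, ← mul_assoc, ← mul_assoc,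
      eq_neg_of_add_eq_zero_left (ExteriorAlgebra.ι_add_mul_swap n n'), neg_mul,
      TensorProduct.neg_tmul]

theorem zeroAct_wedge (g : L.g0) (n : N) (x : ExteriorAlgebra ℂ N ⊗[ℂ] V.carrier) :
    h.zeroAct V g (wedge V.carrier (ExteriorAlgebra.ι ℂ n) x) =
      wedge V.carrier (ExteriorAlgebra.ι ℂ (h.ad g n)) x +
        wedge V.carrier (ExteriorAlgebra.ι ℂ n) (h.zeroAct V g x) := by
  induction x using TensorProduct.induction_on with
  | zero => simp
  | add x y hx hy => simp only [map_add, hx, hy]; abel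
  | tmul a v =>
    simp only [wedge_tmul, zeroAct_tmul, extDer_ι_mul, TensorProduct.add_tmul, map_add]
    abel

theorem exists_raiseAct (p : P) : ∃ D : End ℂ (ExteriorAlgebra ℂ N ⊗[ℂ] V.carrier),
    (∀ v, D (1 ⊗ₜ v) = 0) ∧ ∀ n x, D (wedge V.carrier (ExteriorAlgebra.ι ℂ n) x) =
      h.zeroAct V (h.brPN p n) x - wedge V.carrier (ExteriorAlgebra.ι ℂ n) (D x) := by
  let f : N →ₗ[ℂ] ExteriorAlgebra ℂ N × (V.carrier →ₗ[ℂ] ExteriorAlgebra ℂ N ⊗[ℂ] V.carrier) →ₗ[ℂ]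
      (V.carrier →ₗ[ℂ] ExteriorAlgebra ℂ N ⊗[ℂ] V.carrier) :=
    LinearMap.mk₂ ℂ (fun n z => h.zeroAct V (h.brPN p n) ∘ₗ TensorProduct.mk ℂ _ _ z.1 -
        wedge V.carrier (ExteriorAlgebra.ι ℂ n) ∘ₗ z.2)
      (fun _ _ _ => by ext; simp; abel) (fun _ _ _ => by ext; simp [smul_sub])
      (fun _ _ _ => by ext; simp; abel) (fun _ _ _ => by ext; simp [smul_sub])
  have hf_apply (n a T v) : f n (a, T) v = h.zeroAct V (h.brPN p n) (a ⊗ₜ v) -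
    wedge V.carrier (ExteriorAlgebra.ι ℂ n) (T v) := rfl
  have hf (n : N) (a : ExteriorAlgebra ℂ N)
      (T : V.carrier →ₗ[ℂ] ExteriorAlgebra ℂ N ⊗[ℂ] V.carrier) :
      f n (ExteriorAlgebra.ι ℂ n * a, f n (a, T)) = 0 := by
    have : IsAddTorsionFree (ExteriorAlgebra ℂ N ⊗[ℂ] V.carrier) := .of_isTorsionFree ℂ _
    ext v
    rw [hf_apply, hf_apply, ← wedge_tmul, zeroAct_wedge, ad_brPN_self, map_sub,
      self_eq_neg.mp (wedge_ι_wedge_ι V n n (T v))]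
    simp
  obtain ⟨F, hF_one, hF_ι⟩ := ExteriorAlgebra.exists_recursion (N := N)
    (V := V.carrier →ₗ[ℂ] ExteriorAlgebra ℂ N ⊗[ℂ] V.carrier) f hf 0
  refine ⟨TensorProduct.lift F, fun v => ?_, fun n x => ?_⟩
  · rw [TensorProduct.lift.tmul, hF_one, LinearMap.zero_apply]
  · induction x using TensorProduct.induction_on with
    | zero => simp
    | add x y hx hy => simp only [map_add, hx, hy]; abel
    | tmul a v => rw [wedge_tmul, TensorProduct.lift.tmul, hF_ι, hf_apply, TensorProduct.lift.tmul]

theorem raiseAct_unique {p : P} {D : End ℂ (ExteriorAlgebra ℂ N ⊗[ℂ] V.carrier)}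
    {D' : End ℂ (ExteriorAlgebra ℂ N ⊗[ℂ] V.carrier)}
    (h1 : ∀ v, D (1 ⊗ₜ v) = 0) (h2 : ∀ n x, D (wedge V.carrier (ExteriorAlgebra.ι ℂ n) x) =
      h.zeroAct V (h.brPN p n) x - wedge V.carrier (ExteriorAlgebra.ι ℂ n) (D x))
    (h1' : ∀ v, D' (1 ⊗ₜ v) = 0) (h2' : ∀ n x, D' (wedge V.carrier (ExteriorAlgebra.ι ℂ n) x) =
      h.zeroAct V (h.brPN p n) x - wedge V.carrier (ExteriorAlgebra.ι ℂ n) (D' x)) : D = D' := by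
  refine LinearMap.ext fun x => ?_
  induction x using tmul_wedge_induction with
  | one v => rw [h1, h1']
  | add x y hx hy => rw [map_add, map_add, hx, hy]
  | wedge n x hx => rw [h2, h2', hx]

/-- The action of `P` on `Λ(N) ⊗ V`. -/
def raiseAct : P →ₗ[ℂ] End ℂ (ExteriorAlgebra ℂ N ⊗[ℂ] V.carrier) where
  toFun p := (h.exists_raiseAct V p).choose
  map_add' p q := by
    have hp := (h.exists_raiseAct V p).choose_spec
    have hq := (h.exists_raiseAct V q).choose_spec
    have hpq := (h.exists_raiseAct V (p + q)).choose_spec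
    refine h.raiseAct_unique V hpq.1 hpq.2 (fun v => ?_) (fun n x => ?_)
    · rw [LinearMap.add_apply, hp.1, hq.1, add_zero]
    · simp only [LinearMap.add_apply, hp.2, hq.2, map_add]
      abel
  map_smul' c p := by
    have hp := (h.exists_raiseAct V p).choose_spec
    have hcp := (h.exists_raiseAct V (c • p)).choose_spec
    refine h.raiseAct_unique V hcp.1 hcp.2 (fun v => ?_) (fun n x => ?_)
    · rw [RingHom.id_apply, LinearMap.smul_apply, hp.1, smul_zero]
    · simp only [RingHom.id_apply, LinearMap.smul_apply, hp.2, map_smul, smul_sub]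

theorem raiseAct_one_tmul (p : P) (v : V.carrier) : h.raiseAct V p (1 ⊗ₜ v) = 0 :=
  (h.exists_raiseAct V p).choose_spec.1 v

theorem raiseAct_wedge (p : P) (n : N) (x : ExteriorAlgebra ℂ N ⊗[ℂ] V.carrier) :
    h.raiseAct V p (wedge V.carrier (ExteriorAlgebra.ι ℂ n) x) =
      h.zeroAct V (h.brPN p n) x - wedge V.carrier (ExteriorAlgebra.ι ℂ n) (h.raiseAct V p x) :=
  (h.exists_raiseAct V p).choose_spec.2 n x

theorem zeroAct_bracket (g g' : L.g0) (x : ExteriorAlgebra ℂ N ⊗[ℂ] V.carrier) :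
    h.zeroAct V ⟨L.bracket g g', L.br_00 g g.2 g' g'.2⟩ x =
      h.zeroAct V g (h.zeroAct V g' x) - h.zeroAct V g' (h.zeroAct V g x) := by
  induction x using tmul_wedge_induction with
  | one v => simp only [zeroAct_one_tmul, V.act_br, TensorProduct.tmul_sub]
  | add x y hx hy => simp only [map_add, hx, hy]; abel
  | wedge n x hx =>
    simp only [zeroAct_wedge, hx, bracket_bracket_left, map_add, map_sub, LinearMap.sub_apply]
    abel

theorem raiseAct_ad (g : L.g0) (p : P) (x : ExteriorAlgebra ℂ N ⊗[ℂ] V.carrier) :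
    h.raiseAct V (h.symm.ad g p) x =
      h.zeroAct V g (h.raiseAct V p x) - h.raiseAct V p (h.zeroAct V g x) := by
  induction x using tmul_wedge_induction with
  | one v => simp only [zeroAct_one_tmul, raiseAct_one_tmul, map_zero, sub_zero]
  | add x y hx hy => simp only [map_add, hx, hy]; abel
  | wedge n x hx =>
    have := zeroAct_bracket h V g (h.brPN p n) x
    rw [← brPN_ad, map_add, LinearMap.add_apply] at this
    simp only [zeroAct_wedge, raiseAct_wedge, hx, map_add, map_sub]
    rw [eq_sub_of_add_eq this]
    abel

theorem raiseAct_raiseAct (p q : P) (x : ExteriorAlgebra ℂ N ⊗[ℂ] V.carrier) :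
    h.raiseAct V p (h.raiseAct V q x) + h.raiseAct V q (h.raiseAct V p x) = 0 := by
  induction x using tmul_wedge_induction with
  | one v => simp only [raiseAct_one_tmul, map_zero, add_zero]
  | add x y hx hy =>
    simp only [map_add]
    rw [add_add_add_comm, hx, hy, add_zero]
  | wedge n x hx =>
    have key := h.raiseAct_ad V (h.brPN q n) p x
    have key' := h.raiseAct_ad V (h.brPN p n) q x
    have := congr(h.raiseAct V $(h.ad_brPN_add p q n) x)
    rw [map_add, LinearMap.add_apply, key, key', map_zero, LinearMap.zero_apply] at this
    simp only [raiseAct_wedge, map_sub]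
    rw [eq_neg_of_add_eq_zero_left hx, map_neg, ← neg_eq_zero, ← this]
    abel

/-- The action of `𝔤` on `Λ(N) ⊗ V`. -/
def kacAct : L.carrier →ₗ[ℂ] End ℂ (ExteriorAlgebra ℂ N ⊗[ℂ] V.carrier) :=
  ((h.zeroAct V).coprod ((wedge V.carrier ∘ₗ ExteriorAlgebra.ι ℂ).coprod (h.raiseAct V))) ∘ₗ
    h.decomp.symm.toLinearMap

theorem kacAct_add (g : L.g0) (n : N) (p : P) : h.kacAct V (g + (n + p)) =
    h.zeroAct V g + (wedge V.carrier (ExteriorAlgebra.ι ℂ n) + h.raiseAct V p) := by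
  have : (g + (n + p) : L.carrier) = h.decomp (g, n, p) := rfl
  rw [this, kacAct, LinearMap.comp_apply, LinearEquiv.coe_coe, LinearEquiv.symm_apply_apply]
  rfl

theorem kacAct_zero (g : L.g0) : h.kacAct V g = h.zeroAct V g := by
  simpa using h.kacAct_add V g 0 0

theorem kacAct_left (n : N) : h.kacAct V n = wedge V.carrier (ExteriorAlgebra.ι ℂ n) := by
  simpa using h.kacAct_add V 0 n 0

theorem kacAct_right (p : P) : h.kacAct V p = h.raiseAct V p := by
  simpa using h.kacAct_add V 0 0 p

theorem kacAct_bracket_zero (g : L.g0) (y : L.carrier)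
    (x : ExteriorAlgebra ℂ N ⊗[ℂ] V.carrier) : h.kacAct V (L.bracket g y) x =
      h.kacAct V g (h.kacAct V y x) - h.kacAct V y (h.kacAct V g x) := by
  obtain ⟨g', hg, n, hn, p, hp, rfl⟩ := h.exists_decomp y
  have h0 := h.kacAct_zero V ⟨_, L.br_00 g g.2 g' hg⟩
  have h1 := h.kacAct_left V (h.ad g ⟨n, hn⟩)
  have h2 := h.kacAct_right V (h.symm.ad g ⟨p, hp⟩)
  have h0' := h.zeroAct_bracket V g ⟨g', hg⟩ x
  dsimp only at h0 h0'
  rw [coe_ad] at h1 h2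
  rw [map_add, map_add, map_add, map_add, LinearMap.add_apply, LinearMap.add_apply, h0, h1, h2,
    h.kacAct_add V ⟨g', hg⟩ ⟨n, hn⟩ ⟨p, hp⟩, kacAct_zero, h0', raiseAct_ad]
  simp only [LinearMap.add_apply, map_add, zeroAct_wedge]
  abel

theorem kacAct_bracket_odd {y z : L.carrier} (hy : y ∈ L.odd) (hz : z ∈ L.odd)
    (x : ExteriorAlgebra ℂ N ⊗[ℂ] V.carrier) : h.kacAct V (L.bracket y z) x =
      h.kacAct V y (h.kacAct V z x) + h.kacAct V z (h.kacAct V y x) := by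
  rw [← h.sup_eq] at hy hz
  obtain ⟨n, hn, p, hp, rfl⟩ := Submodule.mem_sup.mp hy
  obtain ⟨n', hn', p', hp', rfl⟩ := Submodule.mem_sup.mp hz
  have h1 := h.kacAct_zero V (h.brPN ⟨p, hp⟩ ⟨n', hn'⟩)
  have h2 := h.kacAct_zero V (h.brPN ⟨p', hp'⟩ ⟨n, hn⟩)
  have h3 := h.kacAct_left V ⟨n, hn⟩
  have h4 := h.kacAct_left V ⟨n', hn'⟩
  have h5 := h.kacAct_right V ⟨p, hp⟩
  have h6 := h.kacAct_right V ⟨p', hp'⟩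
  rw [coe_brPN] at h1 h2
  dsimp only at h1 h2 h3 h4 h5 h6
  simp only [map_add, LinearMap.add_apply]
  rw [L.skew_oo n (h.left_le hn) p' (h.right_le hp'), h.br_NN n hn n' hn', h.br_PP p hp p' hp',
    h1, h2, h3, h4, h5, h6, raiseAct_wedge, raiseAct_wedge, wedge_ι_wedge_ι,
    eq_neg_of_add_eq_zero_left (h.raiseAct_raiseAct V ⟨p, hp⟩ ⟨p', hp'⟩ x)]
  simp only [map_zero, LinearMap.zero_apply]
  abel

/-- Scaling the degree `k` part of `Λ(N) ⊗ V` by `c ^ k`, composed with an endomorphism of `V`. -/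
def scale (c : ℂ) (T : End ℂ V.carrier) : End ℂ (ExteriorAlgebra ℂ N ⊗[ℂ] V.carrier) :=
  TensorProduct.map (dilation c).toLinearMap T

section Scale

omit [FiniteDimensional ℂ N] in
theorem scale_tmul (c : ℂ) (T : End ℂ V.carrier) (a : ExteriorAlgebra ℂ N) (v : V.carrier) :
    scale V c T (a ⊗ₜ v) = dilation c a ⊗ₜ T v := rfl

omit [FiniteDimensional ℂ N] in
theorem scale_one_tmul (c : ℂ) (T : End ℂ V.carrier) (v : V.carrier) :
    scale (N := N) V c T (1 ⊗ₜ v) = 1 ⊗ₜ T v := by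
  rw [scale_tmul, map_one]

omit [FiniteDimensional ℂ N] in
theorem scale_wedge (c : ℂ) (T : End ℂ V.carrier) (n : N)
    (x : ExteriorAlgebra ℂ N ⊗[ℂ] V.carrier) :
    scale V c T (wedge V.carrier (ExteriorAlgebra.ι ℂ n) x) =
      c • wedge V.carrier (ExteriorAlgebra.ι ℂ n) (scale V c T x) := by
  induction x using TensorProduct.induction_on with
  | zero => simp
  | add x y hx hy => simp only [map_add, hx, hy, smul_add]
  | tmul a v =>
    rw [wedge_tmul, scale_tmul, scale_tmul, wedge_tmul, dilation_ι_mul, TensorProduct.smul_tmul']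

omit [FiniteDimensional ℂ N] in
theorem scale_neg_one_wedge (T : End ℂ V.carrier) (n : N)
    (x : ExteriorAlgebra ℂ N ⊗[ℂ] V.carrier) :
    scale V (-1) T (wedge V.carrier (ExteriorAlgebra.ι ℂ n) x) =
      -wedge V.carrier (ExteriorAlgebra.ι ℂ n) (scale V (-1) T x) :=
  (scale_wedge V (-1) T n x).trans (neg_one_smul ℂ (M := ExteriorAlgebra ℂ N ⊗[ℂ] V.carrier) _)

theorem topProj_scale (c : ℂ) (T : End ℂ V.carrier) (x : ExteriorAlgebra ℂ N ⊗[ℂ] V.carrier) :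
    topProj N V.carrier (scale V c T x) = c ^ finrank ℂ N • T (topProj N V.carrier x) := by
  induction x using TensorProduct.induction_on with
  | zero => simp
  | add x y hx hy => simp only [map_add, hx, hy, smul_add]
  | tmul a v =>
    rw [scale_tmul, topProj_tmul, topProj_tmul, topCoeff_dilation, mul_smul, map_smul]

variable {V} {T : End ℂ V.carrier} (hT : ∀ g v, T (V.act g v) = V.act g (T v))

include hT

theorem scale_zeroAct (c : ℂ) (g : L.g0) (x : ExteriorAlgebra ℂ N ⊗[ℂ] V.carrier) :
    scale V c T (h.zeroAct V g x) = h.zeroAct V g (scale V c T x) := by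
  induction x using tmul_wedge_induction with
  | one v => simp only [zeroAct_one_tmul, scale_one_tmul, hT]
  | add x y hx hy => simp only [map_add, hx, hy]
  | wedge n x hx => simp only [zeroAct_wedge, scale_wedge, map_add, map_smul, hx, smul_add]

theorem raiseAct_scale (c : ℂ) (p : P) (x : ExteriorAlgebra ℂ N ⊗[ℂ] V.carrier) :
    h.raiseAct V p (scale V c T x) = c • scale V c T (h.raiseAct V p x) := by
  induction x using tmul_wedge_induction with
  | one v => simp only [raiseAct_one_tmul, scale_one_tmul, map_zero, smul_zero]
  | add x y hx hy => simp only [map_add, hx, hy, smul_add]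
  | wedge n x hx =>
    simp only [raiseAct_wedge, scale_wedge, map_sub, map_smul, hx, smul_sub,
      h.scale_zeroAct hT]

end Scale

theorem parity_act_zero (g : L.g0) (v : V.carrier) :
    parity V.grading (V.act g v) = V.act g (parity V.grading v) :=
  (map_parity V.grading V.grading (V.act g) (V.act_ev g) (V.act_od g) v).symm

omit [FiniteDimensional ℂ N] in
theorem scale_parity_scale_parity (x : ExteriorAlgebra ℂ N ⊗[ℂ] V.carrier) :
    scale V (-1) (parity V.grading) (scale V (-1) (parity V.grading) x) = x := by
  induction x using tmul_wedge_induction with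
  | one v => rw [scale_one_tmul, scale_one_tmul, parity_parity]
  | add x y hx hy => rw [map_add, map_add, hx, hy]
  | wedge n x hx => rw [scale_neg_one_wedge, map_neg, scale_neg_one_wedge, hx, neg_neg]

theorem kacAct_scale_parity_odd {y : L.carrier} (hy : y ∈ L.odd)
    (x : ExteriorAlgebra ℂ N ⊗[ℂ] V.carrier) :
    scale V (-1) (parity V.grading) (h.kacAct V y x) =
      -h.kacAct V y (scale V (-1) (parity V.grading) x) := by
  rw [← h.sup_eq] at hy
  obtain ⟨n, hn, p, hp, rfl⟩ := Submodule.mem_sup.mp hy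
  have h3 := h.kacAct_left V ⟨n, hn⟩
  have h5 := h.kacAct_right V ⟨p, hp⟩
  dsimp only at h3 h5
  have h6 := (h.raiseAct_scale (parity_act_zero V) (-1) ⟨p, hp⟩ x).trans
    (neg_one_smul ℂ (M := ExteriorAlgebra ℂ N ⊗[ℂ] V.carrier) _)
  rw [map_add, LinearMap.add_apply, LinearMap.add_apply, h3, h5, map_add, scale_neg_one_wedge, h6,
    neg_add, neg_neg]

/-- The Kac module on `Λ(N) ⊗ V`. -/
def kacModel : SMod L where
  carrier := ExteriorAlgebra ℂ N ⊗[ℂ] V.carrier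
  act := h.kacAct V
  ev := LinearMap.eqLocus (scale V (-1) (parity V.grading)) LinearMap.id
  od := LinearMap.eqLocus (scale V (-1) (parity V.grading)) (-LinearMap.id)
  grading := isCompl_of_involution _ (scale_parity_scale_parity V)
  act_e_ev g hg x (hx : _ = x) := by
    have := h.scale_zeroAct (parity_act_zero V) (-1) ⟨g, hg⟩ x
    rw [hx, ← kacAct_zero] at this
    exact this
  act_e_od g hg x (hx : _ = -x) := by
    have := h.scale_zeroAct (parity_act_zero V) (-1) ⟨g, hg⟩ x
    rw [hx, ← kacAct_zero, map_neg] at this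
    exact this
  act_o_ev y hy x (hx : _ = x) := by
    have := h.kacAct_scale_parity_odd V hy x
    rwa [hx] at this
  act_o_od y hy x (hx : _ = -x) := by
    have := h.kacAct_scale_parity_odd V hy x
    rwa [hx, map_neg, neg_neg] at this
  act_br_e y z hyz x := by
    rcases hyz with hy | hz
    · exact h.kacAct_bracket_zero V ⟨y, hy⟩ z x
    · have := h.kacAct_bracket_zero V ⟨z, hz⟩ y x
      dsimp only at this
      rw [← neg_eq_iff_eq_neg.mpr (L.skew_e z hz y), map_neg, LinearMap.neg_apply, this, neg_sub]
  act_br_oo y hy z hz x := h.kacAct_bracket_odd V hy hz x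

end IsPolarization

end Model

section Universal

open scoped TensorProduct

namespace IsPolarization

variable {L : GLSA} {N P : Submodule ℂ L.carrier} (h : IsPolarization L N P)
  [FiniteDimensional ℂ N] (V : SMod0 L)

theorem extAct_kacModel (a : ExteriorAlgebra ℂ N) :
    h.extAct (h.kacModel V) a = wedge V.carrier a := by
  induction a using ExteriorAlgebra.ι_mul_induction with
  | one => exact (map_one (h.extAct (h.kacModel V))).trans wedge_one.symm
  | smul r a ha =>
    exact (map_smul (h.extAct _) r a).trans (congr(r • $ha).trans (map_smul _ r a).symm)
  | add a b ha hb =>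
    exact (map_add (h.extAct _) a b).trans (congr($ha + $hb).trans (map_add _ a b).symm)
  | ι_mul n a ha =>
    rw [map_mul, extAct_ι, ha]
    exact congr($(h.kacAct_left V n) ∘ₗ wedge V.carrier a).trans (wedge_mul _ a).symm

/-- The unit `V → Λ(N) ⊗ V`. -/
def kacUnit : V.carrier →ₗ[ℂ] (h.kacModel V).carrier :=
  TensorProduct.mk ℂ (ExteriorAlgebra ℂ N) V.carrier 1

theorem isInvariantMap_kacUnit : IsInvariantMap P V (h.kacModel V) (h.kacUnit V) where
  map_ev v hv := by
    have := scale_one_tmul (N := N) V (-1) (parity V.grading) v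
    rwa [(mem_even_iff V.grading v).mp hv] at this
  map_od v hv := by
    have := scale_one_tmul (N := N) V (-1) (parity V.grading) v
    rwa [(mem_odd_iff V.grading v).mp hv, TensorProduct.tmul_neg] at this
  equivar g v := by
    have := h.zeroAct_one_tmul V g v
    rw [← kacAct_zero] at this
    exact this.symm
  zero p hp v := by
    have := h.raiseAct_one_tmul V ⟨p, hp⟩ v
    rw [← kacAct_right] at this
    exact this

variable {V} {M : SMod L} {φ : V.carrier →ₗ[ℂ] M.carrier}

/-- The linear map `Λ(N) ⊗ V → M` induced by `V → M`. -/
def kacLift (M : SMod L) (φ : V.carrier →ₗ[ℂ] M.carrier) :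
    ExteriorAlgebra ℂ N ⊗[ℂ] V.carrier →ₗ[ℂ] M.carrier :=
  TensorProduct.lift ((h.extAct M).toLinearMap.compl₂ φ)

omit [FiniteDimensional ℂ N] in
theorem kacLift_tmul (a : ExteriorAlgebra ℂ N) (v : V.carrier) :
    h.kacLift M φ (a ⊗ₜ v) = h.extAct M a (φ v) := rfl

omit [FiniteDimensional ℂ N] in
theorem kacLift_one_tmul (v : V.carrier) : h.kacLift M φ (1 ⊗ₜ v) = φ v := by
  rw [kacLift_tmul, map_one, Module.End.one_apply]

omit [FiniteDimensional ℂ N] in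
theorem kacLift_wedge (n : N) (x : ExteriorAlgebra ℂ N ⊗[ℂ] V.carrier) :
    h.kacLift M φ (wedge V.carrier (ExteriorAlgebra.ι ℂ n) x) = M.act n (h.kacLift M φ x) := by
  induction x using TensorProduct.induction_on with
  | zero => simp
  | add x y hx hy => simp only [map_add, hx, hy]
  | tmul a v => rw [wedge_tmul, kacLift_tmul, kacLift_tmul, extAct_ι_mul]

theorem kacLift_zeroAct (hφ : IsInvariantMap P V M φ) (g : L.g0)
    (x : ExteriorAlgebra ℂ N ⊗[ℂ] V.carrier) :
    h.kacLift M φ (h.zeroAct V g x) = M.act g (h.kacLift M φ x) := by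
  induction x using TensorProduct.induction_on with
  | zero => simp
  | add x y hx hy => simp only [map_add, hx, hy]
  | tmul a v =>
    rw [zeroAct_tmul, map_add, kacLift_tmul, kacLift_tmul, kacLift_tmul, act_extAct, hφ.equivar]

theorem kacLift_raiseAct (hφ : IsInvariantMap P V M φ) (p : P)
    (x : ExteriorAlgebra ℂ N ⊗[ℂ] V.carrier) :
    h.kacLift M φ (h.raiseAct V p x) = M.act p (h.kacLift M φ x) := by
  induction x using tmul_wedge_induction with
  | one v => rw [raiseAct_one_tmul, map_zero, kacLift_one_tmul, hφ.zero p p.2]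
  | add x y hx hy => simp only [map_add, hx, hy]
  | wedge n x hx =>
    rw [raiseAct_wedge, map_sub, kacLift_wedge, kacLift_wedge, hx, h.kacLift_zeroAct hφ, coe_brPN,
      M.act_br_oo p (h.right_le p.2) n (h.left_le n.2), add_sub_cancel_right]

theorem kacLift_kacAct (hφ : IsInvariantMap P V M φ) (y : L.carrier)
    (x : ExteriorAlgebra ℂ N ⊗[ℂ] V.carrier) :
    h.kacLift M φ (h.kacAct V y x) = M.act y (h.kacLift M φ x) := by
  obtain ⟨g, hg, n, hn, p, hp, rfl⟩ := h.exists_decomp y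
  rw [h.kacAct_add V ⟨g, hg⟩ ⟨n, hn⟩ ⟨p, hp⟩]
  simp only [LinearMap.add_apply, map_add, kacLift_wedge, h.kacLift_zeroAct hφ,
    h.kacLift_raiseAct hφ]

omit [FiniteDimensional ℂ N] in
theorem kacLift_scale (hφ : IsInvariantMap P V M φ) (x : ExteriorAlgebra ℂ N ⊗[ℂ] V.carrier) :
    h.kacLift M φ (scale V (-1) (parity V.grading) x) = parity M.grading (h.kacLift M φ x) := by
  induction x using tmul_wedge_induction with
  | one v =>
    rw [scale_one_tmul, kacLift_one_tmul, kacLift_one_tmul]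
    exact map_parity V.grading M.grading φ hφ.map_ev hφ.map_od v
  | add x y hx hy => simp only [map_add, hx, hy]
  | wedge n x hx =>
    rw [scale_neg_one_wedge, map_neg, kacLift_wedge, hx, parity_act_odd M (h.left_le n.2), neg_neg,
      kacLift_wedge]

/-- `Λ(N) ⊗ V` is the module induced from `V`. -/
theorem existsUnique_kacModel (hφ : IsInvariantMap P V M φ) :
    ∃! Φ : SHom (h.kacModel V) M, ∀ v, Φ.toLin (h.kacUnit V v) = φ v := by
  refine ⟨⟨h.kacLift M φ, fun x hx => ?_, fun x hx => ?_, h.kacLift_kacAct hφ⟩,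
    h.kacLift_one_tmul, fun Φ hΦ => SHom.ext fun x => ?_⟩
  · have := h.kacLift_scale hφ x
    rw [show _ = x from hx] at this
    exact (mem_even_iff M.grading _).mpr this.symm
  · have := h.kacLift_scale hφ x
    rw [show _ = -x from hx] at this
    replace this := (map_neg (h.kacLift M φ) x).symm.trans this
    exact (mem_odd_iff M.grading _).mpr this.symm
  · change ExteriorAlgebra ℂ N ⊗[ℂ] V.carrier at x
    induction x using TensorProduct.induction_on with
    | zero => exact (map_zero Φ.toLin).trans (map_zero (h.kacLift M φ)).symm
    | add x y hx hy =>
      exact (map_add Φ.toLin x y).trans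
        ((congrArg₂ (· + ·) hx hy).trans (map_add (h.kacLift M φ) x y).symm)
    | tmul a v =>
      refine Eq.trans ?_ (h.kacLift_tmul a v).symm
      rw [← hΦ v, ← toLin_extAct, extAct_kacModel]
      change _ = Φ.toLin (wedge V.carrier a (1 ⊗ₜ v))
      rw [wedge_tmul, mul_one]

theorem topProj_raiseAct (p : P) (x : ExteriorAlgebra ℂ N ⊗[ℂ] V.carrier) :
    topProj N V.carrier (h.raiseAct V p x) = 0 := by
  induction x using TensorProduct.induction_on with
  | zero => simp
  | add x y hx hy => rw [map_add, map_add, hx, hy, add_zero]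
  | tmul a v =>
    refine congr($(eq_zero_of_dilation (topProj N V.carrier ∘ₗ h.raiseAct V p ∘ₗ
      (TensorProduct.mk ℂ _ _).flip v) fun a => ?_) a)
    have h1 := h.raiseAct_scale (V := V) (T := LinearMap.id) (fun _ _ => rfl) 2 p (a ⊗ₜ v)
    have h2 := topProj_scale V 2 LinearMap.id (h.raiseAct V p (a ⊗ₜ v))
    rw [scale_tmul, LinearMap.id_apply] at h1
    rw [LinearMap.id_apply] at h2
    simp only [LinearMap.comp_apply, LinearMap.flip_apply, TensorProduct.mk_apply]
    rw [h1, map_smul, h2, smul_smul, pow_succ']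

theorem topProj_zeroAct (g : L.g0) (x : ExteriorAlgebra ℂ N ⊗[ℂ] V.carrier) :
    topProj N V.carrier (h.zeroAct V g x) =
      V.act g (topProj N V.carrier x) +
        LinearMap.trace ℂ N (h.ad g) • topProj N V.carrier x := by
  induction x using TensorProduct.induction_on with
  | zero => simp
  | add x y hx hy => simp only [map_add, hx, hy, smul_add]; abel
  | tmul a v =>
    rw [zeroAct_tmul, map_add, topProj_tmul, topProj_tmul, topProj_tmul, topCoeff_extDer, map_smul,
      mul_smul, add_comm]

/-- `Λ(N) ⊗ V` projects onto `Λ^max(N) ⊗ V`. -/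
theorem isCoinvariantMap_topProj {W : SMod0 L} (e : V.carrier ≃ₗ[ℂ] W.carrier)
    (he : ∀ g v, W.act g (e v) = e (V.act g v) + LinearMap.trace ℂ N (h.ad g) • e v)
    (hpar : if (finrank ℂ N % 2 == 1) then (∀ v ∈ V.ev, e v ∈ W.od) ∧ (∀ v ∈ V.od, e v ∈ W.ev)
      else (∀ v ∈ V.ev, e v ∈ W.ev) ∧ (∀ v ∈ V.od, e v ∈ W.od)) :
    IsCoinvariantMap P W (h.kacModel V) (e.toLinearMap ∘ₗ topProj N V.carrier) := by
  have hpar' (v : V.carrier) :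
      e ((-1 : ℂ) ^ finrank ℂ N • parity V.grading v) = parity W.grading (e v) := by
    rcases Nat.mod_two_eq_zero_or_one (finrank ℂ N) with hd | hd
    · rw [(Nat.even_iff.mpr hd).neg_one_pow, one_smul]
      simp only [hd] at hpar
      exact map_parity V.grading W.grading e.toLinearMap hpar.1 hpar.2 v
    · rw [(Nat.odd_iff.mpr hd).neg_one_pow, map_smul, neg_one_smul]
      simp only [hd] at hpar
      exact neg_eq_iff_eq_neg.mpr
        (map_parity_of_swap V.grading W.grading e.toLinearMap hpar.1 hpar.2 v)
  refine ⟨fun x hx => ?_, fun x hx => ?_, fun g x => ?_, fun p hp x => ?_⟩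
  · have := congr(e $(topProj_scale V (-1) (parity V.grading) x))
    rw [show _ = x from hx, hpar'] at this
    exact (mem_even_iff W.grading _).mpr this.symm
  · have := congr(e $(topProj_scale V (-1) (parity V.grading) x))
    rw [show _ = -x from hx, hpar'] at this
    replace this := (map_neg (e.toLinearMap ∘ₗ topProj N V.carrier) x).symm.trans this
    exact (mem_odd_iff W.grading _).mpr this.symm
  · have := congr(e $(h.topProj_zeroAct (V := V) g x))
    rw [map_add, map_smul, ← he, ← kacAct_zero] at this
    exact this
  · have := congr(e $(h.topProj_raiseAct (V := V) ⟨p, hp⟩ x))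
    rw [map_zero, ← kacAct_right] at this
    exact this

/-- `Λ(N) ⊗ V` is the module coinduced from `Λ^max(N) ⊗ V`. -/
theorem existsUnique_kacModel_coind {W : SMod0 L} (e : V.carrier ≃ₗ[ℂ] W.carrier)
    (hε : IsCoinvariantMap P W (h.kacModel V) (e.toLinearMap ∘ₗ topProj N V.carrier))
    {ψ : M.carrier →ₗ[ℂ] W.carrier} (hψ : IsCoinvariantMap P W M ψ) :
    ∃! Φ : SHom M (h.kacModel V), ∀ m, e (topProj N V.carrier (Φ.toLin m)) = ψ m := by
  refine h.existsUnique_lift hε (fun f => ?_) (fun x hx => ?_) hψ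
  · obtain ⟨x, hx⟩ := exists_topProj_wedge (e.symm.toLinearMap ∘ₗ f)
    refine ⟨x, fun a => ?_⟩
    rw [extAct_kacModel]
    exact (congr(e $(hx a))).trans (e.apply_symm_apply _)
  · refine eq_zero_of_topProj_wedge x fun a => ?_
    have := hx a
    rw [extAct_kacModel] at this
    exact (LinearEquiv.map_eq_zero_iff e).mp this

end IsPolarization

/-- A homomorphism with a two-sided inverse. -/
def SHom.IsInverse {L : GLSA} {M N : SMod L} (f : SHom M N) (g : SHom N M) : Prop :=
  g.comp f = SHom.id M ∧ f.comp g = SHom.id N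

variable {L : GLSA} {P : Submodule ℂ L.carrier}

theorem SHom.IsInverse.sIsoUpToParity {M N : SMod L} {f : SHom M N} {g : SHom N M}
    (hfg : f.IsInverse g) : SIsoUpToParity M N :=
  ⟨.ofLinearMap f.toLin g.toLin (congrArg toLin hfg.2) (congrArg toLin hfg.1), f.equivar,
    .inl ⟨f.map_ev, f.map_od⟩⟩

theorem SHom.IsInverse.comp {M N K : SMod L} {f : SHom M N} {g : SHom N M} {f' : SHom N K}
    {g' : SHom K N} (hfg : f.IsInverse g) (hfg' : f'.IsInverse g') :
    (f'.comp f).IsInverse (g.comp g') := by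
  constructor
  · change g.comp ((g'.comp f').comp f) = _
    rw [hfg'.1]
    exact hfg.1
  · change f'.comp ((f.comp g).comp g') = _
    rw [hfg.2]
    exact hfg'.2

theorem exists_isInverse_of_induced {V : SMod0 L} {K X : SMod L} {η : V.carrier →ₗ[ℂ] K.carrier}
    {η' : V.carrier →ₗ[ℂ] X.carrier} (hη : IsInvariantMap P V K η) (hη' : IsInvariantMap P V X η')
    (hK : ∀ (M : SMod L) (φ : V.carrier →ₗ[ℂ] M.carrier), IsInvariantMap P V M φ →
      ∃! Φ : SHom K M, ∀ v, Φ.toLin (η v) = φ v)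
    (hX : ∀ (M : SMod L) (φ : V.carrier →ₗ[ℂ] M.carrier), IsInvariantMap P V M φ →
      ∃! Φ : SHom X M, ∀ v, Φ.toLin (η' v) = φ v) :
    ∃ (f : SHom K X) (g : SHom X K), f.IsInverse g := by
  obtain ⟨f, hf, -⟩ := hK X η' hη'
  obtain ⟨g, hg, -⟩ := hX K η hη
  refine ⟨f, g, (hK K η hη).unique (fun v => ?_) fun v => rfl,
    (hX X η' hη').unique (fun v => ?_) fun v => rfl⟩
  · rw [SHom.comp_apply, hf, hg]
  · rw [SHom.comp_apply, hg, hf]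

theorem exists_isInverse_of_coinduced {W : SMod0 L} {C X : SMod L} {ε : C.carrier →ₗ[ℂ] W.carrier}
    {ε' : X.carrier →ₗ[ℂ] W.carrier} (hε : IsCoinvariantMap P W C ε)
    (hε' : IsCoinvariantMap P W X ε')
    (hC : ∀ (M : SMod L) (ψ : M.carrier →ₗ[ℂ] W.carrier), IsCoinvariantMap P W M ψ →
      ∃! Φ : SHom M C, ∀ m, ε (Φ.toLin m) = ψ m)
    (hX : ∀ (M : SMod L) (ψ : M.carrier →ₗ[ℂ] W.carrier), IsCoinvariantMap P W M ψ →
      ∃! Φ : SHom M X, ∀ m, ε' (Φ.toLin m) = ψ m) :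
    ∃ (f : SHom C X) (g : SHom X C), f.IsInverse g := by
  obtain ⟨f, hf, -⟩ := hX C ε hε
  obtain ⟨g, hg, -⟩ := hC X ε' hε'
  refine ⟨f, g, (hC C ε hε).unique (fun v => ?_) fun v => rfl,
    (hX X ε' hε').unique (fun v => ?_) fun v => rfl⟩
  · rw [SHom.comp_apply, hg, hf]
  · rw [SHom.comp_apply, hf, hg]

/-- The module coinduced from `Λ^max(N) ⊗ V` is isomorphic to the module induced from `V`. -/
theorem IsPolarization.sIsoUpToParity {N : Submodule ℂ L.carrier} [FiniteDimensional ℂ N]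
    (h : IsPolarization L N P) {V W : SMod0 L}
    (hVW : IsTwistBy V W (fun g => LinearMap.trace ℂ N (h.ad g)) (finrank ℂ N % 2 == 1))
    {C K : SMod L} {ε : C.carrier →ₗ[ℂ] W.carrier} {η : V.carrier →ₗ[ℂ] K.carrier}
    (hε : IsCoinvariantMap P W C ε)
    (hC : ∀ (M : SMod L) (ψ : M.carrier →ₗ[ℂ] W.carrier), IsCoinvariantMap P W M ψ →
      ∃! Φ : SHom M C, ∀ m, ε (Φ.toLin m) = ψ m)
    (hη : IsInvariantMap P V K η)
    (hK : ∀ (M : SMod L) (φ : V.carrier →ₗ[ℂ] M.carrier), IsInvariantMap P V M φ →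
      ∃! Φ : SHom K M, ∀ v, Φ.toLin (η v) = φ v) : SIsoUpToParity C K := by
  obtain ⟨e, he, hpar⟩ := hVW
  have hε' := h.isCoinvariantMap_topProj e he hpar
  obtain ⟨f, g, hfg⟩ := exists_isInverse_of_coinduced hε hε' hC
    fun M ψ hψ => h.existsUnique_kacModel_coind e hε' hψ
  obtain ⟨f', g', hfg'⟩ := exists_isInverse_of_induced (h.isInvariantMap_kacUnit V) hη
    (fun M φ hφ => h.existsUnique_kacModel hφ) hK
  exact (hfg.comp hfg').sIsoUpToParity

theorem IsTwistBy.symm {V W : SMod0 L} {χ : L.g0 → ℂ} {swap : Bool}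
    (hVW : IsTwistBy V W (fun g => -χ g) swap) : IsTwistBy W V χ swap := by
  obtain ⟨e, he, hpar⟩ := hVW
  refine ⟨e.symm, fun g w => ?_, ?_⟩
  · obtain ⟨v, rfl⟩ := e.surjective w
    rw [e.symm_apply_apply, he, map_add, map_smul, e.symm_apply_apply, e.symm_apply_apply,
      neg_smul, neg_add_cancel_right]
  · cases swap
    · have key (w) : e.symm (parity W.grading w) = parity V.grading (e.symm w) := by
        obtain ⟨v, rfl⟩ := e.surjective w
        rw [e.symm_apply_apply, e.symm_apply_eq]
        exact (map_parity V.grading W.grading e.toLinearMap hpar.1 hpar.2 v).symm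
      exact ⟨fun w hw => map_even W.grading V.grading (T := e.symm.toLinearMap) key hw,
        fun w hw => map_odd W.grading V.grading (T := e.symm.toLinearMap) key hw⟩
    · have key (w) : e.symm (parity W.grading w) = parity V.grading.symm (e.symm w) := by
        obtain ⟨v, rfl⟩ := e.surjective w
        rw [e.symm_apply_apply, e.symm_apply_eq]
        exact (map_parity V.grading.symm W.grading e.toLinearMap hpar.2 hpar.1 v).symm
      exact ⟨fun w hw => map_even W.grading V.grading.symm (T := e.symm.toLinearMap) key hw,
        fun w hw => map_odd W.grading V.grading.symm (T := e.symm.toLinearMap) key hw⟩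

end Universal

theorem IsKac.isInvariantMap {L : GLSA} {V : SMod0 L} {K : SMod L}
    {η : V.carrier →ₗ[ℂ] K.carrier} (h : IsKac V K η) : IsInvariantMap L.gpos V K η :=
  ⟨h.map_ev, h.map_od, h.equivar, h.pos_zero⟩

theorem IsKac'.isInvariantMap {L : GLSA} {V : SMod0 L} {K : SMod L}
    {η : V.carrier →ₗ[ℂ] K.carrier} (h : IsKac' V K η) : IsInvariantMap L.gneg V K η :=
  ⟨h.map_ev, h.map_od, h.equivar, h.neg_zero⟩

theorem IsCoindPos.isCoinvariantMap {L : GLSA} {W : SMod0 L} {C : SMod L}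
    {ε : C.carrier →ₗ[ℂ] W.carrier} (h : IsCoindPos W C ε) : IsCoinvariantMap L.gpos W C ε :=
  ⟨h.map_ev, h.map_od, h.equivar, h.pos_zero⟩

theorem IsCoindNeg.isCoinvariantMap {L : GLSA} {W : SMod0 L} {C : SMod L}
    {ε : C.carrier →ₗ[ℂ] W.carrier} (h : IsCoindNeg W C ε) : IsCoinvariantMap L.gneg W C ε :=
  ⟨h.map_ev, h.map_od, h.equivar, h.neg_zero⟩

theorem sIsoUpToParity_of_isCoindPos_of_isKac {L : GLSA} [FiniteDimensional ℂ L.gneg]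
    {V W : SMod0 L} (hVW : IsTwistBy V W (traceCharNeg L) (parNeg L)) {C K : SMod L}
    {ε : C.carrier →ₗ[ℂ] W.carrier} {η : V.carrier →ₗ[ℂ] K.carrier} (hC : IsCoindPos W C ε)
    (hK : IsKac V K η) : SIsoUpToParity C K :=
  (isPolarization_neg_pos L).sIsoUpToParity hVW hC.isCoinvariantMap
    (fun M ψ hψ => hC.universal M ψ hψ.map_ev hψ.map_od hψ.equivar hψ.zero) hK.isInvariantMap
    fun M φ hφ => hK.universal M φ hφ.map_ev hφ.map_od hφ.equivar hφ.zero

theorem sIsoUpToParity_of_isCoindNeg_of_isKac' {L : GLSA} [FiniteDimensional ℂ L.gpos]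
    {V W : SMod0 L} (hVW : IsTwistBy V W (traceCharPos L) (parPos L)) {C K : SMod L}
    {ε : C.carrier →ₗ[ℂ] W.carrier} {η : V.carrier →ₗ[ℂ] K.carrier} (hC : IsCoindNeg W C ε)
    (hK : IsKac' V K η) : SIsoUpToParity C K :=
  (isPolarization_pos_neg L).sIsoUpToParity hVW hC.isCoinvariantMap
    (fun M ψ hψ => hC.universal M ψ hψ.map_ev hψ.map_od hψ.equivar hψ.zero) hK.isInvariantMap
    fun M φ hφ => hK.universal M φ hφ.map_ev hφ.map_od hφ.equivar hφ.zero

/-- For a simple `𝔤₀`-supermodule `V`, there are isomorphisms of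
`𝔤`-supermodules, up to parity change:
`Coind_{𝔤≥0}^𝔤(Λ^max(𝔤₋₁) ⊗ V) ≅ K(V)` and `Coind_{𝔤≥0}^𝔤(V) ≅ K(Λ^max(𝔤₋₁^*) ⊗ V)`;
similarly, `Coind_{𝔤≤0}^𝔤(Λ^max(𝔤₁) ⊗ V) ≅ K'(V)` and
`Coind_{𝔤≤0}^𝔤(V) ≅ K'(Λ^max(𝔤₁^*) ⊗ V)`. -/
theorem statement_5 (L : GLSA)
    [FiniteDimensional ℂ ↥L.gneg] [FiniteDimensional ℂ ↥L.gpos]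
    (V : SMod0 L) (hV : V.IsSimple) :
    (∀ W : SMod0 L, IsTwistBy V W (traceCharNeg L) (parNeg L) →
      ∀ (C : SMod L) (ε : C.carrier →ₗ[ℂ] W.carrier), IsCoindPos W C ε →
      ∀ (K : SMod L) (η : V.carrier →ₗ[ℂ] K.carrier), IsKac V K η →
        SIsoUpToParity C K) ∧
    (∀ W : SMod0 L, IsTwistBy V W (fun x => -(traceCharNeg L x)) (parNeg L) →
      ∀ (C : SMod L) (ε : C.carrier →ₗ[ℂ] V.carrier), IsCoindPos V C ε →
      ∀ (K : SMod L) (η : W.carrier →ₗ[ℂ] K.carrier), IsKac W K η →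
        SIsoUpToParity C K) ∧
    (∀ W : SMod0 L, IsTwistBy V W (traceCharPos L) (parPos L) →
      ∀ (C : SMod L) (ε : C.carrier →ₗ[ℂ] W.carrier), IsCoindNeg W C ε →
      ∀ (K' : SMod L) (η' : V.carrier →ₗ[ℂ] K'.carrier), IsKac' V K' η' →
        SIsoUpToParity C K') ∧
    (∀ W : SMod0 L, IsTwistBy V W (fun x => -(traceCharPos L x)) (parPos L) →
      ∀ (C : SMod L) (ε : C.carrier →ₗ[ℂ] V.carrier), IsCoindNeg V C ε →
      ∀ (K' : SMod L) (η' : W.carrier →ₗ[ℂ] K'.carrier), IsKac' W K' η' →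
        SIsoUpToParity C K') := by
  exact ⟨fun W hVW C ε hC K η hK => sIsoUpToParity_of_isCoindPos_of_isKac hVW hC hK,
    fun W hVW C ε hC K η hK => sIsoUpToParity_of_isCoindPos_of_isKac hVW.symm hC hK,
    fun W hVW C ε hC K η hK => sIsoUpToParity_of_isCoindNeg_of_isKac' hVW hC hK,
    fun W hVW C ε hC K η hK => sIsoUpToParity_of_isCoindNeg_of_isKac' hVW.symm hC hK⟩
end
end

section
/- Let V be a simple 𝔤₀-supermodule. Then both coinduced 𝔤-supermodules Coind_{𝔤≥0}^𝔤(V) and Coind_{𝔤≤0}^𝔤(V) have simple socle. -/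
noncomputable section

open Module Function

/-- The vector space `Λ(P) ⊗ V` described through left multiplication `e` by elements of `P`, the
embedding `b` of `V`, and the induction and recursion principles along left multiplication. -/
structure ExteriorTensor (P V : Type) [AddCommGroup P] [Module ℂ P] [AddCommGroup V]
    [Module ℂ V] where
  carrier : Type
  [isACG : AddCommGroup carrier]
  [isMod : Module ℂ carrier]
  e : P →ₗ[ℂ] carrier →ₗ[ℂ] carrier
  b : V →ₗ[ℂ] carrier
  e_e : ∀ p w, e p (e p w) = 0
  ind : ∀ S : Submodule ℂ carrier, (∀ v, b v ∈ S) → (∀ p, ∀ w ∈ S, e p w ∈ S) → ∀ w, w ∈ S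
  recursion : ∀ (N : Type) [AddCommGroup N] [Module ℂ N] (G : P →ₗ[ℂ] carrier →ₗ[ℂ] N)
    (E : P →ₗ[ℂ] N →ₗ[ℂ] N) (a : V →ₗ[ℂ] N), (∀ p w, G p (e p w) + E p (G p w) = 0) →
    (∀ p n, E p (E p n) = 0) →
    ∃ A : carrier →ₗ[ℂ] N, (∀ v, A (b v) = a v) ∧ ∀ p w, A (e p w) = G p w + E p (A w)

attribute [instance] ExteriorTensor.isACG ExteriorTensor.isMod

theorem ExteriorTensor.nonempty (P V : Type) [AddCommGroup P] [Module ℂ P] [AddCommGroup V]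
    [Module ℂ V] : Nonempty (ExteriorTensor P V) := by
  let Q : QuadraticForm ℂ P := 0
  refine ⟨⟨TensorProduct ℂ (CliffordAlgebra Q) V,
    (LinearMap.rTensorHom V) ∘ₗ (LinearMap.mul ℂ (CliffordAlgebra Q)) ∘ₗ CliffordAlgebra.ι Q,
    TensorProduct.mk ℂ (CliffordAlgebra Q) V 1, ?_, ?_, ?_⟩⟩
  · intro p w
    induction w with
    | zero => simp
    | add x y hx hy => rw [map_add, map_add, hx, hy, add_zero]
    | tmul x v =>
      simp [← mul_assoc, CliffordAlgebra.ι_sq_scalar, Q]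
  · intro S hb he w
    induction w with
    | zero => exact S.zero_mem
    | add x y hx hy => exact S.add_mem hx hy
    | tmul x v =>
      induction x using CliffordAlgebra.left_induction with
      | algebraMap r =>
        rw [Algebra.algebraMap_eq_smul_one, ← TensorProduct.smul_tmul']
        exact S.smul_mem _ (hb v)
      | add x y hx hy => rw [TensorProduct.add_tmul]; exact S.add_mem hx hy
      | ι_mul x m hx => simpa using he m _ hx
  · intro N _ _ G E a hG hE
    let f : P →ₗ[ℂ] CliffordAlgebra Q × (V →ₗ[ℂ] N) →ₗ[ℂ] (V →ₗ[ℂ] N) :=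
      LinearMap.mk₂ ℂ
        (fun p xF => G p ∘ₗ TensorProduct.mk ℂ (CliffordAlgebra Q) V xF.1 + E p ∘ₗ xF.2)
        (by intros; ext; simp; abel) (by intros; ext; simp)
        (by intros; ext; simp; abel) (by intros; ext; simp)
    have hf : ∀ m x fx, f m (CliffordAlgebra.ι Q m * x, f m (x, fx)) = Q m • fx := by
      intro m x F
      ext v
      have := hG m (x ⊗ₜ v)
      simp at this
      simp [f, Q, hE, this]
    let A := CliffordAlgebra.foldr' Q f hf a
    refine ⟨TensorProduct.lift A, fun v => ?_, fun p w => ?_⟩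
    · have := CliffordAlgebra.foldr'_algebraMap Q f hf a 1
      rw [map_one, one_smul] at this
      simp [A, this]
    · induction w with
      | zero => simp
      | add x y hx hy => simp only [map_add, hx, hy]; abel
      | tmul x v =>
        have := LinearMap.congr_fun (CliffordAlgebra.foldr'_ι_mul Q f hf a p x) v
        simp [A, this]
        simp [f]

theorem eq_zero_of_add_self_eq_zero {M : Type*} [AddCommGroup M] [Module ℂ M] {m : M}
    (h : m + m = 0) : m = 0 := by
  have : (2 : ℂ) • m = 0 := by rw [two_smul, h]
  simpa using this

/-- The grading attached to an involution. -/
theorem isCompl_ker_involution {M : Type*} [AddCommGroup M] [Module ℂ M] (σ : M →ₗ[ℂ] M)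
    (hσ : ∀ m, σ (σ m) = m) :
    IsCompl (LinearMap.ker (σ - LinearMap.id)) (LinearMap.ker (σ + LinearMap.id)) := by
  constructor
  · rw [Submodule.disjoint_def]
    intro m h₁ h₂
    simp only [LinearMap.mem_ker, LinearMap.sub_apply, LinearMap.add_apply, LinearMap.id_coe,
      id_eq] at h₁ h₂
    rw [sub_eq_zero.1 h₁] at h₂
    exact eq_zero_of_add_self_eq_zero h₂
  · rw [codisjoint_iff, eq_top_iff]
    intro m _
    rw [Submodule.mem_sup]
    refine ⟨(1 / 2 : ℂ) • (m + σ m), ?_, (1 / 2 : ℂ) • (m - σ m), ?_, ?_⟩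
    · simp [hσ, add_comm]
    · simp [hσ]
    · module

/-- A grading is given by an involution. -/
theorem exists_involution {M : Type*} [AddCommGroup M] [Module ℂ M] {p q : Submodule ℂ M}
    (h : IsCompl p q) : ∃ σ : M →ₗ[ℂ] M, (∀ m, σ (σ m) = m) ∧ (∀ m, m ∈ p ↔ σ m = m) ∧
      ∀ m, m ∈ q ↔ σ m = -m := by
  have hP : ∀ m, p.projection q h (p.projection q h m) = p.projection q h m := fun m =>
    Submodule.projection_apply_left h ⟨_, Submodule.projection_apply_mem h m⟩
  refine ⟨(2 : ℂ) • p.projection q h - LinearMap.id, fun m => ?_, fun m => ⟨fun hm => ?_,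
    fun hm => ?_⟩, fun m => ⟨fun hm => ?_, fun hm => ?_⟩⟩
  · simp only [LinearMap.sub_apply, LinearMap.smul_apply, LinearMap.id_apply, map_sub, map_smul, hP]
    module
  · have := Submodule.projection_apply_left h ⟨m, hm⟩
    simp only at this
    simp only [LinearMap.sub_apply, LinearMap.smul_apply, LinearMap.id_apply, this]
    module
  · simp only [LinearMap.sub_apply, LinearMap.smul_apply, LinearMap.id_apply] at hm
    have : p.projection q h m = m := by
      linear_combination (norm := module) (1 / 2 : ℂ) • hm
    exact this ▸ Submodule.projection_apply_mem h m
  · simp [(Submodule.projection_apply_eq_zero_iff h).2 hm]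
  · simpa using hm

namespace GLSA

variable (L : GLSA)

theorem exists_projections : ∃ (πn : L.carrier →ₗ[ℂ] L.gneg) (π0 : L.carrier →ₗ[ℂ] L.g0)
    (πp : L.carrier →ₗ[ℂ] L.gpos), (∀ x : L.gneg, πn x = x ∧ π0 x = 0 ∧ πp x = 0) ∧
      (∀ x : L.g0, πn x = 0 ∧ π0 x = x ∧ πp x = 0) ∧
      (∀ x : L.gpos, πn x = 0 ∧ π0 x = 0 ∧ πp x = x) := by
  have h0 := L.oddCompl
  have hn : IsCompl L.gneg (L.g0 ⊔ L.gpos) := by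
    constructor
    · rw [sup_comm]
      exact L.disjNP.disjoint_sup_right_of_disjoint_sup_left h0.disjoint.symm
    · have := h0.codisjoint
      rw [codisjoint_iff] at this ⊢
      rw [← this, sup_left_comm]
  have hp : IsCompl L.gpos (L.g0 ⊔ L.gneg) := by
    constructor
    · rw [sup_comm]
      refine L.disjNP.symm.disjoint_sup_right_of_disjoint_sup_left ?_
      rw [sup_comm]
      exact h0.disjoint.symm
    · have := h0.codisjoint
      rw [codisjoint_iff] at this ⊢
      rw [← this, sup_left_comm, sup_comm L.gpos]
  refine ⟨Submodule.projectionOnto _ _ hn, Submodule.projectionOnto _ _ h0,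
    Submodule.projectionOnto _ _ hp, fun x => ⟨?_, ?_, ?_⟩, fun x => ⟨?_, ?_, ?_⟩,
    fun x => ⟨?_, ?_, ?_⟩⟩
  · exact Submodule.projectionOnto_apply_left hn x
  · exact (Submodule.projectionOnto_apply_eq_zero_iff h0).2 (Submodule.mem_sup_left x.2)
  · exact (Submodule.projectionOnto_apply_eq_zero_iff hp).2 (Submodule.mem_sup_right x.2)
  · exact (Submodule.projectionOnto_apply_eq_zero_iff hn).2 (Submodule.mem_sup_left x.2)
  · exact Submodule.projectionOnto_apply_left h0 x
  · exact (Submodule.projectionOnto_apply_eq_zero_iff hp).2 (Submodule.mem_sup_left x.2)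
  · exact (Submodule.projectionOnto_apply_eq_zero_iff hn).2 (Submodule.mem_sup_right x.2)
  · exact (Submodule.projectionOnto_apply_eq_zero_iff h0).2 (Submodule.mem_sup_right x.2)
  · exact Submodule.projectionOnto_apply_left hp x

theorem exists_decomposition (x : L.carrier) :
    ∃ (n : L.gneg) (h : L.g0) (p : L.gpos), x = n + h + p := by
  have hx : x ∈ L.g0 ⊔ (L.gneg ⊔ L.gpos) := by rw [L.oddCompl.sup_eq_top]; trivial
  obtain ⟨h, hh, z, hz, rfl⟩ := Submodule.mem_sup.1 hx
  obtain ⟨n, hn, p, hp, rfl⟩ := Submodule.mem_sup.1 hz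
  exact ⟨⟨n, hn⟩, ⟨h, hh⟩, ⟨p, hp⟩, by dsimp; abel⟩

/-- The brackets between the graded pieces. -/
def br00 : L.g0 →ₗ[ℂ] L.g0 →ₗ[ℂ] L.g0 :=
  LinearMap.mk₂ ℂ (fun x y => ⟨L.bracket x y, L.br_00 x x.2 y y.2⟩)
    (by intros; ext; simp) (by intros; ext; simp) (by intros; ext; simp) (by intros; ext; simp)

def br0p : L.g0 →ₗ[ℂ] L.gpos →ₗ[ℂ] L.gpos :=
  LinearMap.mk₂ ℂ (fun x y => ⟨L.bracket x y, L.br_0p x x.2 y y.2⟩)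
    (by intros; ext; simp) (by intros; ext; simp) (by intros; ext; simp) (by intros; ext; simp)

def br0n : L.g0 →ₗ[ℂ] L.gneg →ₗ[ℂ] L.gneg :=
  LinearMap.mk₂ ℂ (fun x y => ⟨L.bracket x y, L.br_0n x x.2 y y.2⟩)
    (by intros; ext; simp) (by intros; ext; simp) (by intros; ext; simp) (by intros; ext; simp)

def brpn : L.gpos →ₗ[ℂ] L.gneg →ₗ[ℂ] L.g0 :=
  LinearMap.mk₂ ℂ (fun x y => ⟨L.bracket x y, L.br_pn x x.2 y y.2⟩)
    (by intros; ext; simp) (by intros; ext; simp) (by intros; ext; simp) (by intros; ext; simp)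

variable {L}

theorem br00_br0p (h h' : L.g0) (p : L.gpos) :
    L.br0p (L.br00 h h') p = L.br0p h (L.br0p h' p) - L.br0p h' (L.br0p h p) := by
  ext
  simp [br00, br0p, L.jacobi_e h h' p (Or.inl h.2)]

theorem br0p_brpn_self (p : L.gpos) (n : L.gneg) : L.br0p (L.brpn p n) p = 0 := by
  ext
  have hp : (p : L.carrier) ∈ L.gneg ⊔ L.gpos := Submodule.mem_sup_right p.2
  have hn : (n : L.carrier) ∈ L.gneg ⊔ L.gpos := Submodule.mem_sup_left n.2
  have h₁ := L.jacobi_oo p hp n hn p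
  have h₂ := L.skew_e _ (L.br_pn p p.2 n n.2) p
  have h₃ := L.jacobi_oo p hp p hp n
  rw [L.skew_oo n hn p hp] at h₁
  rw [L.br_pp p p.2 p p.2, map_zero, LinearMap.zero_apply, zero_sub, eq_neg_iff_add_eq_zero] at h₃
  simp [br0p, brpn, h₂, eq_zero_of_add_self_eq_zero h₃]

theorem br00_brpn (h : L.g0) (p : L.gpos) (n : L.gneg) :
    L.br00 h (L.brpn p n) = L.brpn (L.br0p h p) n + L.brpn p (L.br0n h n) := by
  ext
  simp [br00, br0p, br0n, brpn, L.jacobi_e h p n (Or.inl h.2)]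

theorem br0n_brpn (p : L.gpos) (n n' : L.gneg) :
    L.br0n (L.brpn p n) n' + L.br0n (L.brpn p n') n = 0 := by
  ext
  have hp : (p : L.carrier) ∈ L.gneg ⊔ L.gpos := Submodule.mem_sup_right p.2
  have hn : (n : L.carrier) ∈ L.gneg ⊔ L.gpos := Submodule.mem_sup_left n.2
  have hn' : (n' : L.carrier) ∈ L.gneg ⊔ L.gpos := Submodule.mem_sup_left n'.2
  have h₁ := L.jacobi_oo n hn n' hn' p
  rw [L.br_nn n n.2 n' n'.2, map_zero, LinearMap.zero_apply, L.skew_oo n' hn' p hp,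
    L.skew_oo n hn p hp] at h₁
  simp [br0n, brpn, L.skew_e _ (L.br_pn p p.2 n n.2) n', L.skew_e _ (L.br_pn p p.2 n' n'.2) n, h₁]

end GLSA

namespace ExteriorTensor

variable {P V : Type} [AddCommGroup P] [Module ℂ P] [AddCommGroup V] [Module ℂ V]

theorem hom_ext (T : ExteriorTensor P V) {N : Type*} [AddCommGroup N] [Module ℂ N]
    (f g : T.carrier →ₗ[ℂ] N) (hb : ∀ v, f (T.b v) = g (T.b v))
    (he : ∀ p w, f w = g w → f (T.e p w) = g (T.e p w)) (w : T.carrier) : f w = g w :=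
  T.ind (LinearMap.eqLocus f g) hb he w

theorem e_anticomm (T : ExteriorTensor P V) (p p' : P) (w : T.carrier) :
    T.e p (T.e p' w) + T.e p' (T.e p w) = 0 := by
  have := T.e_e (p + p') w
  simpa [T.e_e] using this

end ExteriorTensor

/-- The data of the module induced from `𝔤≤0`: operators by which `𝔤₋₁`, `𝔤₀` act on
`Λ(𝔤₁) ⊗ V`, the parity operator, and the projection to `V`. -/
theorem exists_operators (L : GLSA) (V : SMod0 L) (T : ExteriorTensor L.gpos V.carrier) :
    ∃ (D : L.g0 →ₗ[ℂ] T.carrier →ₗ[ℂ] T.carrier) (B : L.gneg →ₗ[ℂ] T.carrier →ₗ[ℂ] T.carrier),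
      (∀ h v, D h (T.b v) = T.b (V.act h v)) ∧
      (∀ h p w, D h (T.e p w) = T.e (L.br0p h p) w + T.e p (D h w)) ∧
      (∀ n v, B n (T.b v) = 0) ∧
      (∀ n p w, B n (T.e p w) = D (L.brpn p n) w - T.e p (B n w)) ∧
      (∀ h h' w, D (L.br00 h h') w = D h (D h' w) - D h' (D h w)) ∧
      (∀ h n w, B (L.br0n h n) w = D h (B n w) - B n (D h w)) ∧
      (∀ n n' w, B n (B n' w) + B n' (B n w) = 0) := by
  obtain ⟨A, hAb, hAe⟩ := T.recursion (L.g0 →ₗ[ℂ] T.carrier)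
    (LinearMap.mk₂ ℂ (fun p w => (T.e.flip w) ∘ₗ (L.br0p.flip p))
      (by intros; ext; simp) (by intros; ext; simp) (by intros; ext; simp) (by intros; ext; simp))
    (LinearMap.mk₂ ℂ (fun p F => T.e p ∘ₗ F)
      (by intros; ext; simp) (by intros; ext; simp) (by intros; ext; simp) (by intros; ext; simp))
    (V.act.flip.compr₂ T.b) (by intro p w; ext h; simp [T.e_anticomm])
    (by intro p F; ext h; simp [T.e_e])
  have hDb : ∀ h v, A.flip h (T.b v) = T.b (V.act h v) := fun h v => by simp [hAb]
  have hDe : ∀ h p w, A.flip h (T.e p w) = T.e (L.br0p h p) w + T.e p (A.flip h w) :=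
    fun h p w => by simp [hAe]
  generalize A.flip = D at hDb hDe
  obtain ⟨A', hAb', hAe'⟩ := T.recursion (L.gneg →ₗ[ℂ] T.carrier)
    (LinearMap.mk₂ ℂ (fun p w => (D.flip w) ∘ₗ (L.brpn p))
      (by intros; ext; simp) (by intros; ext; simp) (by intros; ext; simp) (by intros; ext; simp))
    (LinearMap.mk₂ ℂ (fun p F => - (T.e p ∘ₗ F))
      (by intros; ext; simp; abel) (by intros; ext; simp) (by intros; ext; simp; abel)
      (by intros; ext; simp))
    0 (by intro p w; ext n; simp [hDe, L.br0p_brpn_self]) (by intro p F; ext h; simp [T.e_e])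
  have hBb : ∀ n v, A'.flip n (T.b v) = 0 := fun h v => by simp [hAb']
  have hBe : ∀ n p w, A'.flip n (T.e p w) = D (L.brpn p n) w - T.e p (A'.flip n w) :=
    fun h p w => by simp [hAe', sub_eq_add_neg]
  generalize A'.flip = B at hBb hBe
  have h00 : ∀ h h' w, D (L.br00 h h') w = D h (D h' w) - D h' (D h w) := by
    intro h h'
    refine T.hom_ext (D (L.br00 h h')) (D h ∘ₗ D h' - D h' ∘ₗ D h) (fun v => ?_) fun p w hw => ?_
    · simp only [LinearMap.sub_apply, LinearMap.comp_apply, hDb, ← map_sub]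
      exact congrArg T.b (V.act_br h h' v)
    · simp only [LinearMap.sub_apply, LinearMap.comp_apply, hDe, map_add] at hw ⊢
      rw [hw, L.br00_br0p, map_sub, map_sub, LinearMap.sub_apply]
      abel
  have h0n : ∀ h n w, B (L.br0n h n) w = D h (B n w) - B n (D h w) := by
    intro h n
    refine T.hom_ext (B (L.br0n h n)) (D h ∘ₗ B n - B n ∘ₗ D h) (fun v => ?_) fun p w hw => ?_
    · simp [hBb, hDb]
    · simp only [LinearMap.sub_apply, LinearMap.comp_apply, hDe, hBe, map_add, map_sub] at hw ⊢
      have := h00 h (L.brpn p n) w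
      rw [L.br00_brpn, map_add, LinearMap.add_apply] at this
      rw [hw, map_sub, eq_sub_of_add_eq' this]
      abel
  refine ⟨D, B, hDb, hDe, hBb, hBe, h00, h0n, fun n n' => ?_⟩
  refine T.hom_ext (B n ∘ₗ B n' + B n' ∘ₗ B n) 0 (fun v => ?_) fun p w hw => ?_
  · simp [hBb]
  · simp only [LinearMap.add_apply, LinearMap.comp_apply, hBe, map_sub, LinearMap.zero_apply]
      at hw ⊢
    have h₁ := h0n (L.brpn p n) n' w
    have h₂ := h0n (L.brpn p n') n w
    have h₃ : B (L.br0n (L.brpn p n) n') w + B (L.br0n (L.brpn p n') n) w = 0 := by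
      rw [← LinearMap.add_apply, ← map_add, L.br0n_brpn, map_zero, LinearMap.zero_apply]
    rw [h₁, h₂] at h₃
    have h₄ : T.e p (B n (B n' w)) + T.e p (B n' (B n w)) = 0 := by
      rw [← map_add, hw, map_zero]
    linear_combination (norm := module) (-1 : ℂ) • h₃ + h₄

/-- There is a supermodule, induced from `𝔤≤0`, with a surjection to `V` that is a homomorphism
over `𝔤≥0`. -/
theorem exists_surjective_hom (L : GLSA) (V : SMod0 L) :
    ∃ (M : SMod L) (ψ : M.carrier →ₗ[ℂ] V.carrier),
      (∀ m ∈ M.ev, ψ m ∈ V.ev) ∧ (∀ m ∈ M.od, ψ m ∈ V.od) ∧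
      (∀ (x : L.g0) (m : M.carrier), ψ (M.act ↑x m) = V.act x (ψ m)) ∧
      (∀ x ∈ L.gpos, ∀ m : M.carrier, ψ (M.act x m) = 0) ∧ Surjective ψ := by
  obtain ⟨T⟩ := ExteriorTensor.nonempty L.gpos V.carrier
  obtain ⟨D, B, hDb, hDe, hBb, hBe, h00, h0n, hnn⟩ := exists_operators L V T
  obtain ⟨τ, hττ, hτev, hτod⟩ := exists_involution V.grading
  have hτact : ∀ h v, τ (V.act h v) = V.act h (τ v) := by
    intro h v
    have hv : v ∈ V.ev ⊔ V.od := by rw [V.grading.sup_eq_top]; trivial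
    obtain ⟨a, ha, c, hc, rfl⟩ := Submodule.mem_sup.1 hv
    simp only [map_add, (hτev _).1 ha, (hτod _).1 hc, (hτev _).1 (V.act_ev h a ha),
      (hτod _).1 (V.act_od h c hc), map_neg]
  obtain ⟨σ, hσb, hσe⟩ := T.recursion T.carrier 0 (-T.e) (T.b ∘ₗ τ) (by simp)
    (by simp [T.e_e])
  obtain ⟨ψ, hψb, hψe⟩ := T.recursion V.carrier 0 0 LinearMap.id (by simp) (by simp)
  simp only [LinearMap.comp_apply, LinearMap.neg_apply, LinearMap.zero_apply, zero_add] at hσb hσe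
  simp only [LinearMap.id_apply, LinearMap.zero_apply, zero_add] at hψb hψe
  have hσσ : ∀ w, σ (σ w) = w :=
    T.hom_ext (σ ∘ₗ σ) LinearMap.id (fun v => by simp [hσb, hττ]) fun p w hw => by
      simp only [LinearMap.comp_apply, LinearMap.id_apply] at hw
      simp [hσe, hw]
  have hσD : ∀ h w, σ (D h w) = D h (σ w) := fun h =>
    T.hom_ext (σ ∘ₗ D h) (D h ∘ₗ σ) (fun v => by simp [hσb, hDb, hτact]) fun p w hw => by
      simp only [LinearMap.comp_apply] at hw
      simp only [LinearMap.comp_apply, hσe, hDe, map_add, map_neg, hw]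
      abel
  have hσB : ∀ n w, σ (B n w) = - B n (σ w) := fun n =>
    T.hom_ext (σ ∘ₗ B n) (-(B n ∘ₗ σ)) (fun v => by simp [hσb, hBb]) fun p w hw => by
      simp only [LinearMap.comp_apply, LinearMap.neg_apply] at hw
      simp only [LinearMap.comp_apply, LinearMap.neg_apply, hσe, hBe, map_sub, map_neg, hw, hσD]
      abel
  have hψσ : ∀ w, ψ (σ w) = τ (ψ w) :=
    T.hom_ext (ψ ∘ₗ σ) (τ ∘ₗ ψ) (fun v => by simp [hσb, hψb]) fun p w hw => by
      simp [hσe, hψe]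
  have hψD : ∀ h w, ψ (D h w) = V.act h (ψ w) := fun h =>
    T.hom_ext (ψ ∘ₗ D h) (V.act h ∘ₗ ψ) (fun v => by simp [hDb, hψb]) fun p w hw => by
      simp [hDe, hψe]
  obtain ⟨πn, π0, πp, hn, h0, hp⟩ := L.exists_projections
  let act : L.carrier →ₗ[ℂ] T.carrier →ₗ[ℂ] T.carrier := B ∘ₗ πn + D ∘ₗ π0 + T.e ∘ₗ πp
  have actn : ∀ n : L.gneg, act n = B n := fun n => by simp [act, hn]
  have act0 : ∀ h : L.g0, act h = D h := fun h => by simp [act, h0]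
  have actp : ∀ p : L.gpos, act p = T.e p := fun p => by simp [act, hp]
  clear_value act
  obtain ⟨ev, od, hcompl, hev, hod⟩ : ∃ ev od : Submodule ℂ T.carrier, IsCompl ev od ∧
      (∀ w, w ∈ ev ↔ σ w = w) ∧ ∀ w, w ∈ od ↔ σ w = -w :=
    ⟨_, _, isCompl_ker_involution σ hσσ, fun w => by simp [sub_eq_zero],
      fun w => by simp [add_eq_zero_iff_eq_neg]⟩
  have hψev : ∀ m ∈ ev, ψ m ∈ V.ev := fun m hm => by rw [hτev, ← hψσ, (hev m).1 hm]
  have hψod : ∀ m ∈ od, ψ m ∈ V.od := fun m hm => by rw [hτod, ← hψσ, (hod m).1 hm, map_neg]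
  have hψ0 : ∀ (h : L.g0) m, ψ (act h m) = V.act h (ψ m) := fun h m => by rw [act0, hψD]
  have hψp : ∀ x ∈ L.gpos, ∀ m, ψ (act x m) = 0 := fun x hx m => by
    lift x to L.gpos using hx
    rw [actp, hψe]
  have hσodd : ∀ x ∈ L.odd, ∀ w, σ (act x w) = - act x (σ w) := by
    intro x hx w
    obtain ⟨n, hn, p, hp, rfl⟩ := Submodule.mem_sup.1 hx
    lift n to L.gneg using hn
    lift p to L.gpos using hp
    simp only [map_add, LinearMap.add_apply, actn, actp, hσB, hσe]
    abel
  have hbr : ∀ (h : L.g0) (y : L.carrier) (w : T.carrier),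
      act (L.bracket h y) w = act h (act y w) - act y (act h w) := by
    intro h y w
    obtain ⟨n, h', p, rfl⟩ := L.exists_decomposition y
    have e₁ : act (L.bracket h n) w = B (L.br0n h n) w := by rw [← actn]; rfl
    have e₂ : act (L.bracket h h') w = D (L.br00 h h') w := by rw [← act0]; rfl
    have e₃ : act (L.bracket h p) w = T.e (L.br0p h p) w := by rw [← actp]; rfl
    simp only [map_add, LinearMap.add_apply, e₁, e₂, e₃, actn, act0, actp, h0n, h00, hDe]
    abel
  refine ⟨⟨T.carrier, act, ev, od, hcompl, ?_, ?_, ?_, ?_, ?_, ?_⟩, ψ, hψev, hψod, hψ0,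
    hψp, fun v => ⟨T.b v, hψb v⟩⟩
  · intro x hx m hm
    lift x to L.g0 using hx
    rw [hev] at hm ⊢
    rw [act0, hσD, hm]
  · intro x hx m hm
    lift x to L.g0 using hx
    rw [hod] at hm ⊢
    rw [act0, hσD, hm, map_neg]
  · intro x hx m hm
    rw [hev] at hm
    rw [hod, hσodd x hx, hm]
  · intro x hx m hm
    rw [hod] at hm
    rw [hev, hσodd x hx, hm, map_neg, neg_neg]
  · rintro x y (hx | hy) m
    · lift x to L.g0 using hx
      exact hbr x y m
    · rw [← neg_neg (L.bracket x y), ← L.skew_e y hy x, map_neg, LinearMap.neg_apply,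
        hbr ⟨y, hy⟩ x m, neg_sub]
  · intro x hx y hy m
    obtain ⟨n, hn, p, hp, rfl⟩ := Submodule.mem_sup.1 hx
    obtain ⟨n', hn', p', hp', rfl⟩ := Submodule.mem_sup.1 hy
    have e₁ := L.br_nn n hn n' hn'
    have e₂ := L.br_pp p hp p' hp'
    have e₃ := L.skew_oo n (Submodule.mem_sup_left hn) p' (Submodule.mem_sup_right hp')
    lift n to L.gneg using hn
    lift p to L.gpos using hp
    lift n' to L.gneg using hn'
    lift p' to L.gpos using hp'
    have e₄ : ∀ (p : L.gpos) (n : L.gneg), act (L.bracket p n) m = B n (T.e p m) + T.e p (B n m) :=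
      fun p n => by
        rw [hBe, sub_add_cancel, ← act0]; rfl
    simp only [map_add, LinearMap.add_apply, e₁, e₂, e₃, e₄, actn, actp, map_zero,
      LinearMap.zero_apply]
    linear_combination (norm := module) - hnn n n' m - T.e_anticomm p p' m

theorem le_inf_sup_inf_iff {M : Type*} [AddCommGroup M] [Module ℂ M] {p q : Submodule ℂ M}
    (h : IsCompl p q) (N : Submodule ℂ M) :
    N ≤ N ⊓ p ⊔ N ⊓ q ↔ ∀ a ∈ p, ∀ b ∈ q, a + b ∈ N → a ∈ N := by
  constructor
  · intro hN a ha b hb hab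
    obtain ⟨a', ha', b', hb', h'⟩ := Submodule.mem_sup.1 (hN hab)
    have : a - a' = 0 := Submodule.disjoint_def.1 h.disjoint _ (p.sub_mem ha ha'.2) (by
      have : a - a' = b' - b := by rw [sub_eq_sub_iff_add_eq_add, ← h', add_comm]
      rw [this]
      exact q.sub_mem hb'.2 hb)
    rw [sub_eq_zero.1 this]
    exact ha'.1
  · intro hN x hx
    have hx' : x ∈ p ⊔ q := by rw [h.sup_eq_top]; trivial
    obtain ⟨a, ha, b, hb, rfl⟩ := Submodule.mem_sup.1 hx'
    have haN := hN a ha b hb hx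
    exact Submodule.mem_sup.2 ⟨a, ⟨haN, ha⟩, b, ⟨by simpa using N.sub_mem hx haN, hb⟩, rfl⟩

namespace SMod

variable {L : GLSA} {C : SMod L}

/-- The supermodule structure on a sub-supermodule. -/
def restrict (C : SMod L) (N : Submodule ℂ C.carrier) (hN : C.IsSubmod N) : SMod L where
  carrier := N
  act := LinearMap.mk₂ ℂ (fun x m => ⟨C.act x m, hN.1 x m m.2⟩)
    (by intros; ext; simp) (by intros; ext; simp) (by intros; ext; simp) (by intros; ext; simp)
  ev := C.ev.comap N.subtype
  od := C.od.comap N.subtype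
  grading := by
    constructor
    · rw [Submodule.disjoint_def]
      intro m h₁ h₂
      exact Subtype.ext (Submodule.disjoint_def.1 C.grading.disjoint m h₁ h₂)
    · rw [codisjoint_iff, eq_top_iff]
      rintro ⟨m, hm⟩ -
      obtain ⟨a, ha, b, hb, rfl⟩ := Submodule.mem_sup.1 (hN.2 hm)
      exact Submodule.mem_sup.2 ⟨⟨a, ha.1⟩, ha.2, ⟨b, hb.1⟩, hb.2, rfl⟩
  act_e_ev := fun x hx m hm => C.act_e_ev x hx m hm
  act_e_od := fun x hx m hm => C.act_e_od x hx m hm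
  act_o_ev := fun x hx m hm => C.act_o_ev x hx m hm
  act_o_od := fun x hx m hm => C.act_o_od x hx m hm
  act_br_e := fun x y h m => Subtype.ext (C.act_br_e x y h m)
  act_br_oo := fun x hx y hy m => Subtype.ext (C.act_br_oo x hx y hy m)

theorem isSubmod_sInf {S : Set (Submodule ℂ C.carrier)} (hS : ∀ N ∈ S, C.IsSubmod N) :
    C.IsSubmod (sInf S) := by
  refine ⟨fun x m hm => ?_, (le_inf_sup_inf_iff C.grading _).2 fun a ha b hb hab => ?_⟩
  · rw [Submodule.mem_sInf] at hm ⊢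
    exact fun N hN => (hS N hN).1 x m (hm N hN)
  · rw [Submodule.mem_sInf] at hab ⊢
    exact fun N hN => (le_inf_sup_inf_iff C.grading _).1 (hS N hN).2 a ha b hb (hab N hN)

theorem isSubmod_gen (S : Submodule ℂ C.carrier) : C.IsSubmod (C.gen S) :=
  isSubmod_sInf fun _ hN => hN.1

theorem le_gen (S : Submodule ℂ C.carrier) : S ≤ C.gen S := le_sInf fun _ hN => hN.2

theorem gen_le {S N : Submodule ℂ C.carrier} (hN : C.IsSubmod N) (h : S ≤ N) : C.gen S ≤ N :=
  sInf_le ⟨hN, h⟩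

/-- If a nonzero subspace lies in every nonzero sub-supermodule, the socle is simple. -/
theorem isSimpleSub_socle_of_le {I : Submodule ℂ C.carrier} (hI : I ≠ ⊥)
    (h : ∀ N, C.IsSubmod N → N ≠ ⊥ → I ≤ N) : C.IsSimpleSub C.socle := by
  have hgen : C.IsSimpleSub (C.gen I) :=
    ⟨isSubmod_gen I, fun h0 => hI (le_bot_iff.1 (h0 ▸ le_gen I)), fun N hN hle => by
      by_cases hN0 : N = ⊥
      · exact Or.inl hN0
      · exact Or.inr (le_antisymm hle (gen_le hN (h N hN hN0)))⟩
  have : C.socle = C.gen I := by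
    refine le_antisymm (sSup_le fun N hN => ?_) (le_sSup hgen)
    obtain h0 | h0 := hN.2.2 _ (isSubmod_gen I) (gen_le hN.1 (h N hN.1 hN.2.1))
    · exact absurd h0 hgen.2.1
    · exact h0.ge
  rw [this]
  exact hgen

theorem act_act_neg (C : SMod L) {x y : L.carrier} (hx : x ∈ L.gneg) (hy : y ∈ L.gneg)
    (m : C.carrier) : C.act x (C.act y m) + C.act y (C.act x m) = 0 := by
  rw [← C.act_br_oo x (Submodule.mem_sup_left hx) y (Submodule.mem_sup_left hy), L.br_nn x hx y hy,
    map_zero, LinearMap.zero_apply]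

/-- As `𝔤₋₁` acts by finitely many anticommuting operators of square zero, a nonzero submodule has
nonzero invariants. -/
theorem inf_invNeg_ne_bot [FiniteDimensional ℂ L.gneg] {N : Submodule ℂ C.carrier}
    (hN : C.IsSubmod N) (h0 : N ≠ ⊥) : N ⊓ C.invNeg ≠ ⊥ := by
  have key : ∀ s : Finset L.carrier, (∀ x ∈ s, x ∈ L.gneg) →
      ∃ c ∈ N, c ≠ 0 ∧ ∀ x ∈ s, C.act x c = 0 := by
    classical
    intro s
    induction s using Finset.induction_on with
    | empty =>
      obtain ⟨c, hc, hc0⟩ := N.ne_bot_iff.1 h0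
      exact fun _ => ⟨c, hc, hc0, by simp⟩
    | insert y s _ ih =>
      intro hs
      have hy := hs y (Finset.mem_insert_self y s)
      obtain ⟨c, hc, hc0, hsc⟩ := ih fun x hx => hs x (Finset.mem_insert_of_mem hx)
      by_cases hyc : C.act y c = 0
      · refine ⟨c, hc, hc0, fun x hx => ?_⟩
        obtain rfl | hx := Finset.mem_insert.1 hx
        exacts [hyc, hsc x hx]
      · refine ⟨C.act y c, hN.1 y c hc, hyc, fun x hx => ?_⟩
        obtain rfl | hx' := Finset.mem_insert.1 hx
        · exact eq_zero_of_add_self_eq_zero (C.act_act_neg hy hy c)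
        · simpa [hsc x hx'] using C.act_act_neg (hs x hx) hy c
  obtain ⟨s, hs⟩ := Module.Finite.iff_fg.1 ‹FiniteDimensional ℂ L.gneg›
  obtain ⟨c, hc, hc0, hsc⟩ := key s fun x hx => hs ▸ Submodule.subset_span hx
  refine (Submodule.ne_bot_iff _).2 ⟨c, ⟨hc, fun x hx => ?_⟩, hc0⟩
  have hle : L.gneg ≤ LinearMap.ker (C.act.flip c) := by
    rw [← hs, Submodule.span_le]
    exact fun x hx => hsc x hx
  exact hle hx

theorem act_mem_invNeg {x : L.carrier} (hx : x ∈ L.g0) {m : C.carrier} (hm : m ∈ C.invNeg) :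
    C.act x m ∈ C.invNeg := by
  intro y hy
  have h₁ := C.act_br_e x y (Or.inl hx) m
  rw [hm y hy, hm _ (L.br_0n x hx y hy), map_zero, zero_sub, eq_comm, neg_eq_zero] at h₁
  exact h₁

theorem mem_invNeg_of_add {a b : C.carrier} (ha : a ∈ C.ev) (hb : b ∈ C.od)
    (hab : a + b ∈ C.invNeg) : a ∈ C.invNeg := by
  intro y hy
  have hy' : y ∈ L.odd := Submodule.mem_sup_left hy
  have h₁ := hab y hy
  rw [map_add] at h₁
  refine Submodule.disjoint_def.1 C.grading.disjoint _ ?_ (C.act_o_ev y hy' a ha)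
  rw [eq_neg_of_add_eq_zero_left h₁]
  exact C.ev.neg_mem (C.act_o_od y hy' b hb)

end SMod

namespace IsCoindPos

variable {L : GLSA} {V : SMod0 L} {C : SMod L} {ε : C.carrier →ₗ[ℂ] V.carrier}

theorem eq_bot_of_le_ker (h : IsCoindPos V C ε) {N : Submodule ℂ C.carrier} (hN : C.IsSubmod N)
    (hε : N ≤ LinearMap.ker ε) : N = ⊥ := by
  obtain ⟨Φ, -, hΦ⟩ := h.universal (C.restrict N hN) 0 (by simp) (by simp) (by simp) (by simp)
  let Φ₁ : SHom (C.restrict N hN) C := ⟨N.subtype, fun _ hm => hm, fun _ hm => hm, fun _ _ => rfl⟩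
  let Φ₂ : SHom (C.restrict N hN) C := ⟨0, by simp, by simp, by simp⟩
  have h₁ : Φ₁ = Φ := hΦ Φ₁ fun m => hε m.2
  have h₂ : Φ₂ = Φ := hΦ Φ₂ fun m => map_zero ε
  rw [eq_bot_iff]
  intro m hm
  exact LinearMap.congr_fun (congrArg SHom.toLin (h₁.trans h₂.symm)) ⟨m, hm⟩

theorem invNeg_inf_ker (h : IsCoindPos V C ε) : C.invNeg ⊓ LinearMap.ker ε = ⊥ := by
  set A := C.invNeg ⊓ LinearMap.ker ε
  let F : Set (Submodule ℂ C.carrier) :=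
    {N | A ≤ N ∧ (∀ x ∈ L.g0, ∀ m ∈ N, C.act x m ∈ N) ∧ ∀ x ∈ L.gpos, ∀ m ∈ N, C.act x m ∈ N}
  have hSF : sInf F ∈ F := by
    refine ⟨le_sInf fun N hN => hN.1, fun x hx m hm => ?_, fun x hx m hm => ?_⟩
    · rw [Submodule.mem_sInf] at hm ⊢
      exact fun N hN => hN.2.1 x hx m (hm N hN)
    · rw [Submodule.mem_sInf] at hm ⊢
      exact fun N hN => hN.2.2 x hx m (hm N hN)
  have hSε : sInf F ≤ LinearMap.ker ε := by
    refine sInf_le ⟨inf_le_right, fun x hx m hm => ?_, fun x hx m _ => h.pos_zero x hx m⟩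
    rw [LinearMap.mem_ker] at hm ⊢
    rw [h.equivar ⟨x, hx⟩ m, hm, map_zero]
  have hSneg : ∀ y ∈ L.gneg, ∀ m ∈ sInf F, C.act y m ∈ sInf F := by
    let T : Submodule ℂ C.carrier := sInf F ⊓ ⨅ y : L.gneg, (sInf F).comap (C.act y)
    have hT : ∀ m, m ∈ T ↔ m ∈ sInf F ∧ ∀ y ∈ L.gneg, C.act y m ∈ sInf F := fun m => by
      simp only [T, Submodule.mem_inf, Submodule.mem_iInf, Submodule.mem_comap, Subtype.forall]
    have hTF : T ∈ F := by
      refine ⟨fun m hm => (hT m).2 ⟨hSF.1 hm, fun y hy => ?_⟩, fun x hx m hm => ?_,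
        fun x hx m hm => ?_⟩
      · rw [hm.1 y hy]
        exact Submodule.zero_mem _
      · rw [hT] at hm ⊢
        refine ⟨hSF.2.1 x hx m hm.1, fun y hy => ?_⟩
        have := C.act_br_e x y (Or.inl hx) m
        rw [eq_sub_iff_add_eq'] at this
        rw [← sub_eq_of_eq_add this.symm]
        exact Submodule.sub_mem _ (hSF.2.1 x hx _ (hm.2 y hy)) (hm.2 _ (L.br_0n x hx y hy))
      · rw [hT] at hm ⊢
        refine ⟨hSF.2.2 x hx m hm.1, fun y hy => ?_⟩
        have := C.act_br_oo x (Submodule.mem_sup_right hx) y (Submodule.mem_sup_left hy) m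
        rw [← sub_eq_of_eq_add' this]
        exact Submodule.sub_mem _ (hSF.2.1 _ (L.br_pn x hx y hy) m hm.1)
          (hSF.2.2 x hx _ (hm.2 y hy))
    exact fun y hy m hm => ((hT m).1 (sInf_le hTF hm)).2 y hy
  have hS : C.IsSubmod (sInf F) := by
    refine ⟨fun x m hm => ?_, sInf_le ⟨?_, fun x hx m hm => ?_, fun x hx m hm => ?_⟩⟩
    · obtain ⟨n, h, p, rfl⟩ := L.exists_decomposition x
      simp only [map_add, LinearMap.add_apply]
      exact Submodule.add_mem _ (Submodule.add_mem _ (hSneg n n.2 m hm) (hSF.2.1 h h.2 m hm))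
        (hSF.2.2 p p.2 m hm)
    · have hA : A ≤ A ⊓ C.ev ⊔ A ⊓ C.od := by
        rw [le_inf_sup_inf_iff C.grading]
        intro a ha b hb hab
        refine ⟨SMod.mem_invNeg_of_add ha hb hab.1, ?_⟩
        refine Submodule.disjoint_def.1 V.grading.disjoint _ (h.map_ev a ha) ?_
        have h₁ : ε (a + b) = 0 := hab.2
        rw [map_add] at h₁
        rw [eq_neg_of_add_eq_zero_left h₁]
        exact V.od.neg_mem (h.map_od b hb)
      exact hA.trans (sup_le_sup (inf_le_inf_right _ hSF.1) (inf_le_inf_right _ hSF.1))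
    · obtain ⟨a, ha, b, hb, rfl⟩ := Submodule.mem_sup.1 hm
      rw [map_add]
      exact Submodule.add_mem_sup ⟨hSF.2.1 x hx a ha.1, C.act_e_ev x hx a ha.2⟩
        ⟨hSF.2.1 x hx b hb.1, C.act_e_od x hx b hb.2⟩
    · obtain ⟨a, ha, b, hb, rfl⟩ := Submodule.mem_sup.1 hm
      have hx' : x ∈ L.odd := Submodule.mem_sup_right hx
      rw [map_add, add_comm]
      exact Submodule.add_mem_sup ⟨hSF.2.2 x hx b hb.1, C.act_o_od x hx' b hb.2⟩
        ⟨hSF.2.2 x hx a ha.1, C.act_o_ev x hx' a ha.2⟩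
  exact le_bot_iff.1 (h.eq_bot_of_le_ker hS hSε ▸ hSF.1)

theorem top_ne_bot (h : IsCoindPos V C ε) (hV : V.IsSimple) :
    (⊤ : Submodule ℂ C.carrier) ≠ ⊥ := by
  obtain ⟨M, ψ, hev, hod, h0, hp, hsurj⟩ := exists_surjective_hom L V
  obtain ⟨Φ, hΦ, -⟩ := h.universal M ψ hev hod h0 hp
  obtain ⟨v, -, hv⟩ := (Submodule.ne_bot_iff _).1 hV.1
  obtain ⟨m, rfl⟩ := hsurj v
  refine (Submodule.ne_bot_iff _).2 ⟨Φ.toLin m, trivial, fun hm => hv ?_⟩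
  rw [← hΦ m, hm, map_zero]

theorem invNeg_le [FiniteDimensional ℂ L.gneg] (h : IsCoindPos V C ε) (hV : V.IsSimple)
    {N : Submodule ℂ C.carrier} (hN : C.IsSubmod N) (h0 : N ≠ ⊥) : C.invNeg ≤ N := by
  have hinj : ∀ c ∈ C.invNeg, ε c = 0 → c = 0 := fun c hc hε => by
    have : c ∈ C.invNeg ⊓ LinearMap.ker ε := ⟨hc, hε⟩
    rwa [h.invNeg_inf_ker] at this
  have htop : (N ⊓ C.invNeg).map ε = ⊤ := by
    refine (hV.2 _ ⟨?_, ?_⟩).resolve_left fun hbot => ?_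
    · rintro x _ ⟨c, hc, rfl⟩
      exact ⟨C.act x c, ⟨hN.1 x c hc.1, SMod.act_mem_invNeg x.2 hc.2⟩, h.equivar x c⟩
    · rintro _ ⟨c, hc, rfl⟩
      have hgr : N ⊓ C.invNeg ≤ N ⊓ C.invNeg ⊓ C.ev ⊔ N ⊓ C.invNeg ⊓ C.od :=
        (le_inf_sup_inf_iff C.grading _).2 fun a ha b hb hab =>
          ⟨(le_inf_sup_inf_iff C.grading _).1 hN.2 a ha b hb hab.1,
            SMod.mem_invNeg_of_add ha hb hab.2⟩
      obtain ⟨a, ha, b, hb, rfl⟩ := Submodule.mem_sup.1 (hgr hc)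
      rw [map_add]
      exact Submodule.add_mem_sup ⟨⟨a, ha.1, rfl⟩, h.map_ev a ha.2⟩
        ⟨⟨b, hb.1, rfl⟩, h.map_od b hb.2⟩
    · obtain ⟨c, hc, hc0⟩ := (Submodule.ne_bot_iff _).1 (SMod.inf_invNeg_ne_bot hN h0)
      have : ε c ∈ (N ⊓ C.invNeg).map ε := ⟨c, hc, rfl⟩
      rw [hbot] at this
      exact hc0 (hinj c hc.2 this)
  intro c hc
  obtain ⟨c', hc', he⟩ : ε c ∈ (N ⊓ C.invNeg).map ε := htop ▸ trivial
  have := hinj (c' - c) (Submodule.sub_mem _ hc'.2 hc) (by rw [map_sub, he, sub_self])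
  rw [← sub_eq_zero.1 this]
  exact hc'.1

theorem isSimpleSub_socle [FiniteDimensional ℂ L.gneg] (h : IsCoindPos V C ε)
    (hV : V.IsSimple) : C.IsSimpleSub C.socle := by
  have hinv : C.invNeg ≠ ⊥ := by
    have htop : C.IsSubmod ⊤ := ⟨fun _ _ _ => trivial, by simp [C.grading.sup_eq_top]⟩
    simpa using SMod.inf_invNeg_ne_bot htop (h.top_ne_bot hV)
  exact SMod.isSimpleSub_socle_of_le hinv fun N hN h0 => h.invNeg_le hV hN h0

end IsCoindPos

/-- The opposite `ℤ`-grading on the same Lie superalgebra. -/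
def GLSA.opp (L : GLSA) : GLSA where
  carrier := L.carrier
  bracket := L.bracket
  gneg := L.gpos
  g0 := L.g0
  gpos := L.gneg
  oddCompl := sup_comm L.gneg L.gpos ▸ L.oddCompl
  disjNP := L.disjNP.symm
  br_00 := L.br_00
  br_0p := L.br_0n
  br_0n := L.br_0p
  br_pn := fun x hx y hy => by
    rw [L.skew_oo x (Submodule.mem_sup_left hx) y (Submodule.mem_sup_right hy)]
    exact L.br_pn y hy x hx
  br_pp := L.br_nn
  br_nn := L.br_pp
  skew_e := L.skew_e
  skew_oo := sup_comm L.gneg L.gpos ▸ L.skew_oo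
  jacobi_e := L.jacobi_e
  jacobi_oo := sup_comm L.gneg L.gpos ▸ L.jacobi_oo

theorem GLSA.odd_opp (L : GLSA) : L.opp.odd = L.odd := sup_comm L.gpos L.gneg

def SMod.opp {L : GLSA} (M : SMod L) : SMod L.opp where
  carrier := M.carrier
  act := M.act
  ev := M.ev
  od := M.od
  grading := M.grading
  act_e_ev := M.act_e_ev
  act_e_od := M.act_e_od
  act_o_ev := L.odd_opp ▸ M.act_o_ev
  act_o_od := L.odd_opp ▸ M.act_o_od
  act_br_e := M.act_br_e
  act_br_oo := L.odd_opp ▸ M.act_br_oo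

def SMod0.opp {L : GLSA} (V : SMod0 L) : SMod0 L.opp where
  carrier := V.carrier
  act := V.act
  ev := V.ev
  od := V.od
  grading := V.grading
  act_ev := V.act_ev
  act_od := V.act_od
  act_br := V.act_br

theorem IsCoindNeg.opp {L : GLSA} {V : SMod0 L} {C : SMod L} {ε : C.carrier →ₗ[ℂ] V.carrier}
    (h : IsCoindNeg V C ε) : IsCoindPos V.opp C.opp ε where
  map_ev := h.map_ev
  map_od := h.map_od
  equivar := h.equivar
  pos_zero := h.neg_zero
  universal := fun M ψ hev hod h0 hp => by
    obtain ⟨Φ, hΦ, huniq⟩ := h.universal M.opp ψ hev hod h0 hp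
    refine ⟨⟨Φ.toLin, Φ.map_ev, Φ.map_od, Φ.equivar⟩, hΦ, fun Ψ hΨ => ?_⟩
    rw [← huniq ⟨Ψ.toLin, Ψ.map_ev, Ψ.map_od, Ψ.equivar⟩ hΨ]

/-- Let `V` be a simple `𝔤₀`-supermodule.  Then both coinduced
`𝔤`-supermodules `Coind_{𝔤≥0}^𝔤(V)` and `Coind_{𝔤≤0}^𝔤(V)` have simple socle. -/
theorem statement_6 (L : GLSA)
    [FiniteDimensional ℂ ↥L.gneg] [FiniteDimensional ℂ ↥L.gpos]
    (V : SMod0 L) (hV : V.IsSimple) :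
    (∀ (C : SMod L) (ε : C.carrier →ₗ[ℂ] V.carrier), IsCoindPos V C ε →
      C.IsSimpleSub C.socle) ∧
    (∀ (C : SMod L) (ε : C.carrier →ₗ[ℂ] V.carrier), IsCoindNeg V C ε →
      C.IsSimpleSub C.socle) := by
  refine ⟨fun C ε h => h.isSimpleSub_socle hV, fun C ε h => ?_⟩
  have : FiniteDimensional ℂ L.opp.gneg := ‹FiniteDimensional ℂ L.gpos›
  exact h.opp.isSimpleSub_socle (V := V.opp) hV
end
end
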